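/- arXiv:1405.0593 — 8 statements merged into one kernel-verified Lean document; each statement's English description precedes it below -/
import Mathlib

section
/- Let X_1,...,X_n be positive random variables such that X_1 is regularly varying with index -α for some α≥0 (i.e., lim_{t→∞} P(X_1>tx)/P(X_1>t)=x^{-α} for all x>0), lim_{t→∞} P(X_i>t)/P(X_1>t)=λ_i ∈ [0,∞) for all i (so λ_1=1), and lim_{t→∞} P(X_i>t, X_j>t)/P(X_1>t)=0 for every pair i<j with λ_i>0 and λ_j>0. Let C=(C_1,...,C_n) be a random vector independent of (X_1,...,X_n) with C_1>0, E[C_1^β]<∞ for some β>α, and E[max_{2≤i≤n}|C_i|^γ] ∈ (0,∞) for some γ>α. Then, as t→∞, P(Σ_{i=1}^k C_i X_{i,n} > t) ~ P(C_1 X_{1,n} > t) ~ E[C_1^α] (Σ_{i=1}^n λ_i) P(X_1>t). -/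
open MeasureTheory ProbabilityTheory Filter Real

/-- `orderStat X i ω` is the `i`-th largest value among `X 0 ω, …, X (n-1) ω`
(decreasing rearrangement, so `orderStat X 0` is the maximum). -/
noncomputable def orderStat {Ω : Type*} {n : ℕ} (X : Fin n → Ω → ℝ) (i : Fin n) (ω : Ω) : ℝ :=
  ((Multiset.map (fun j => X j ω) (Finset.univ : Finset (Fin n)).val).sort (· ≤ ·)).getD
    (n - 1 - (i : ℕ)) 0

/-- The decreasing rearrangement is realised by a permutation of the indices. -/
lemma exists_perm_orderStat {Ω : Type*} {n : ℕ} (X : Fin n → Ω → ℝ) (ω : Ω) :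
    ∃ σ : Equiv.Perm (Fin n),
      (∀ i, orderStat X i ω = X (σ i) ω) ∧ Antitone fun i => X (σ i) ω := by
  set f : Fin n → ℝ := fun j => X j ω
  have hmono := Tuple.monotone_sort f
  have hL : (Multiset.map f (Finset.univ : Finset (Fin n)).val).sort (· ≤ ·)
      = List.ofFn (f ∘ Tuple.sort f) := by
    refine List.Perm.eq_of_pairwise (le := (· ≤ ·)) (fun a b _ _ => le_antisymm)
      (Multiset.pairwise_sort _ _) hmono.sortedLE_ofFn.pairwise ?_
    rw [← Multiset.coe_eq_coe, Multiset.sort_eq]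
    rw [Multiset.coe_eq_coe.2 (Equiv.Perm.ofFn_comp_perm (Tuple.sort f) f)]
    simp [Fin.univ_val_map]
  refine ⟨Fin.revPerm.trans (Tuple.sort f), fun i => ?_, fun i j hij => ?_⟩
  · have hi := i.isLt
    unfold orderStat
    rw [hL, List.getD_eq_getElem _ _ (by simp; omega), List.getElem_ofFn]
    simp only [Function.comp, Equiv.trans_apply, Fin.revPerm_apply, f]
    congr 3
    omega
  · exact hmono (Fin.rev_le_rev.2 hij)

lemma orderStat_zero {Ω : Type*} {n : ℕ} (X : Fin (n + 1) → Ω → ℝ) (ω : Ω) :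
    orderStat X 0 ω = ⨆ i, X i ω := by
  obtain ⟨σ, hσ, hanti⟩ := exists_perm_orderStat X ω
  rw [hσ]
  refine le_antisymm (Finite.le_ciSup (fun i => X i ω) _) (ciSup_le fun i => ?_)
  simpa using hanti (Fin.zero_le (σ.symm i))

/-- The maximum of `min (X i) (X j)` over `i < j` (and of `0`, for `i ≥ j`). -/
noncomputable def pairMax {Ω : Type*} {n : ℕ} (X : Fin n → Ω → ℝ) (ω : Ω) : ℝ :=
  ⨆ p : Fin n × Fin n, if p.1 < p.2 then min (X p.1 ω) (X p.2 ω) else 0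

lemma measurable_pairMax {Ω : Type*} [MeasurableSpace Ω] {n : ℕ} {X : Fin n → Ω → ℝ}
    (hX : ∀ i, Measurable (X i)) : Measurable (pairMax X) := by
  refine Measurable.iSup fun p => ?_
  split_ifs
  · exact (hX _).min (hX _)
  · exact measurable_const

lemma orderStat_le_pairMax {Ω : Type*} {n : ℕ} (X : Fin (n + 1) → Ω → ℝ) (ω : Ω)
    {i : Fin (n + 1)} (hi : i ≠ 0) : orderStat X i ω ≤ pairMax X ω := by
  obtain ⟨σ, hσ, hanti⟩ := exists_perm_orderStat X ω
  have key (a b : Fin (n + 1)) (hab : a < b) : min (X a ω) (X b ω) ≤ pairMax X ω := by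
    have := Finite.le_ciSup (fun p : Fin (n + 1) × Fin (n + 1) =>
      if p.1 < p.2 then min (X p.1 ω) (X p.2 ω) else 0) (a, b)
    simpa [hab, pairMax] using this
  have h0 : X (σ i) ω ≤ X (σ 0) ω := hanti (Fin.zero_le i)
  rw [hσ]
  rcases lt_or_gt_of_ne (σ.injective.ne hi) with h | h
  · simpa [h0] using key _ _ h
  · simpa [h0] using key _ _ h

lemma exists_lt_of_lt_pairMax {Ω : Type*} {n : ℕ} (X : Fin (n + 1) → Ω → ℝ) {ω : Ω} {t : ℝ}
    (ht : 0 ≤ t) (h : t < pairMax X ω) : ∃ i j, i < j ∧ t < X i ω ∧ t < X j ω := by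
  obtain ⟨p, hp⟩ := exists_eq_ciSup_of_finite (f := fun p : Fin (n + 1) × Fin (n + 1) =>
      if p.1 < p.2 then min (X p.1 ω) (X p.2 ω) else 0)
  rw [pairMax, ← hp] at h
  split_ifs at h with hlt
  · exact ⟨p.1, p.2, hlt, lt_min_iff.1 h⟩
  · exact absurd h (not_lt.2 ht)

/-- A Potter-type bound for a function that is regularly varying with index `-α`. -/
lemma exists_potter_bound {F : ℝ → ℝ} (hF : Antitone F) (hpos : ∀ t, 0 < F t)
    (hF1 : ∀ t, F t ≤ 1) {α β : ℝ} (hβ0 : 0 ≤ β) (hβ : α < β)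
    (h2 : Tendsto (fun t => F (t * 2⁻¹) / F t) atTop (nhds ((2⁻¹ : ℝ) ^ (-α)))) :
    ∃ K, 0 ≤ K ∧ ∀ᶠ t in atTop, ∀ y, 0 < y → F (t / y) ≤ K * (1 + y ^ β) * F t := by
  have hlt : ((2⁻¹ : ℝ) ^ (-α)) < 2 ^ β := by
    rw [Real.inv_rpow (by norm_num), Real.rpow_neg (by norm_num), inv_inv]
    exact Real.rpow_lt_rpow_of_exponent_lt (by norm_num) hβ
  obtain ⟨t₀, ht₀⟩ := eventually_atTop.1 ((h2.eventually (gt_mem_nhds hlt)).and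
    (eventually_gt_atTop (0 : ℝ)))
  have ht₀pos : 0 < t₀ := (ht₀ t₀ le_rfl).2
  have hstep (s : ℝ) (hs : t₀ ≤ s) : F s ≤ 2 ^ β * F (2 * s) := by
    have := (ht₀ (2 * s) (by linarith)).1.le
    rw [div_le_iff₀ (hpos _)] at this
    rwa [mul_comm 2 s, mul_inv_cancel_right₀ two_ne_zero, mul_comm s 2] at this
  have hiter (m : ℕ) : ∀ s, t₀ ≤ s → F s ≤ ((2 : ℝ) ^ β) ^ m * F (2 ^ m * s) := by
    induction m with
    | zero => intro s _; simp
    | succ m ih =>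
      intro s hs
      calc F s ≤ 2 ^ β * F (2 * s) := hstep s hs
        _ ≤ 2 ^ β * (((2 : ℝ) ^ β) ^ m * F (2 ^ m * (2 * s))) := by
          gcongr; exact ih _ (by linarith)
        _ = _ := by rw [← mul_assoc, ← pow_succ', pow_succ (2 : ℝ) m, mul_assoc _ 2 s]
  have hscale (s y : ℝ) (hs : t₀ ≤ s) (hy : 1 ≤ y) : F s ≤ 2 ^ β * y ^ β * F (y * s) := by
    obtain ⟨m, hm1, hm2⟩ := exists_nat_pow_near hy (one_lt_two : (1 : ℝ) < 2)
    have hpow : ((2 : ℝ) ^ β) ^ (m + 1) ≤ 2 ^ β * y ^ β := by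
      rw [pow_succ', ← Real.rpow_natCast, ← Real.rpow_mul (by norm_num), mul_comm β,
        Real.rpow_mul (by norm_num), Real.rpow_natCast]
      gcongr
    have hs0 : 0 ≤ s := by linarith
    calc F s ≤ ((2 : ℝ) ^ β) ^ (m + 1) * F (2 ^ (m + 1) * s) := hiter _ s hs
      _ ≤ (2 ^ β * y ^ β) * F (y * s) := by
        have := hF (mul_le_mul_of_nonneg_right hm2.le hs0)
        have := (hpos (2 ^ (m + 1) * s)).le
        gcongr
  have h2β : (1 : ℝ) ≤ 2 ^ β := Real.one_le_rpow (by norm_num) hβ0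
  have hKle : (2 : ℝ) ^ β ≤ 2 ^ β / F t₀ := le_div_self (by positivity) (hpos _) (hF1 _)
  refine ⟨2 ^ β / F t₀, by have := hpos t₀; positivity, ?_⟩
  filter_upwards [eventually_ge_atTop t₀] with t ht y hy
  have htpos : 0 < t := ht₀pos.trans_le ht
  have hyβ : 0 ≤ y ^ β := by positivity
  have hFt := hpos t
  rcases le_total y 1 with hy1 | hy1
  · calc F (t / y) ≤ F t := hF (by rw [le_div_iff₀ hy]; nlinarith)
      _ = 1 * (1 + 0) * F t := by ring
      _ ≤ _ := by gcongr; exacts [zero_le_one.trans (h2β.trans hKle), h2β.trans hKle]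
  · rcases le_total t₀ (t / y) with hty | hty
    · calc F (t / y) ≤ 2 ^ β * y ^ β * F (y * (t / y)) := hscale _ _ hty hy1
        _ = 2 ^ β * y ^ β * F t := by congr 2; field_simp
        _ ≤ _ := by
          have : 0 ≤ 2 ^ β / F t₀ := by linarith
          gcongr; exact le_add_of_nonneg_left zero_le_one
    · have h1 : F t₀ ≤ 2 ^ β * y ^ β * F t := by
        calc F t₀ ≤ 2 ^ β * (t / t₀) ^ β * F (t / t₀ * t₀) :=
              hscale _ _ le_rfl (by rwa [le_div_iff₀ ht₀pos, one_mul])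
          _ = 2 ^ β * (t / t₀) ^ β * F t := by congr 2; field_simp
          _ ≤ _ := by
            have : t / t₀ ≤ y := by
              rw [div_le_iff₀ hy] at hty
              rw [div_le_iff₀ ht₀pos]; linarith
            gcongr
      calc F (t / y) ≤ 1 := hF1 _
        _ ≤ 2 ^ β * y ^ β * F t / F t₀ := by rwa [one_le_div (hpos _)]
        _ = 2 ^ β / F t₀ * y ^ β * F t := by ring
        _ ≤ _ := by
          have := hpos t₀
          gcongr; linarith

lemma antitone_measureReal_gt {Ω : Type*} [MeasurableSpace Ω] (μ : Measure Ω)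
    [IsFiniteMeasure μ] (Z : Ω → ℝ) : Antitone fun t => μ.real {ω | Z ω > t} :=
  fun _ _ hst => measureReal_mono fun _ hω => lt_of_le_of_lt hst hω

lemma measureReal_mul_gt_eq_integral {Ω : Type*} [MeasurableSpace Ω] {μ : Measure Ω}
    [IsProbabilityMeasure μ] {Y Z : Ω → ℝ} (hY : Measurable Y) (hZ : Measurable Z)
    (hYpos : ∀ ω, 0 < Y ω) (hind : IndepFun Y Z μ) (t : ℝ) :
    μ.real {ω | Y ω * Z ω > t} = ∫ ω, μ.real {ω' | Z ω' > t / Y ω} ∂μ := by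
  have hS : MeasurableSet {p : ℝ × ℝ | p.2 > t / p.1} :=
    measurableSet_lt (measurable_const.div measurable_fst) measurable_snd
  have hset : {ω | Y ω * Z ω > t} = (fun ω => (Y ω, Z ω)) ⁻¹' {p : ℝ × ℝ | p.2 > t / p.1} := by
    ext ω
    simp only [Set.mem_ofPred_eq, Set.mem_preimage, gt_iff_lt]
    rw [div_lt_iff₀ (hYpos ω), mul_comm]
  have hmeas : Measurable fun y => μ.map Z (Prod.mk y ⁻¹' {p : ℝ × ℝ | p.2 > t / p.1}) :=
    measurable_measure_prodMk_left hS
  have hpre (y : ℝ) : μ.map Z (Prod.mk y ⁻¹' {p : ℝ × ℝ | p.2 > t / p.1})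
      = μ {ω' | Z ω' > t / y} := by
    rw [Measure.map_apply hZ (measurable_prodMk_left hS)]; rfl
  rw [measureReal_def, hset, ← Measure.map_apply (hY.prodMk hZ) hS,
    (indepFun_iff_map_prod_eq_prod_map_map hY.aemeasurable hZ.aemeasurable).1 hind,
    Measure.prod_apply hS, lintegral_map hmeas hY]
  simp_rw [hpre] at hmeas ⊢
  exact (integral_toReal (hmeas.comp hY).aemeasurable (ae_of_all _ fun _ => measure_lt_top _ _)).symm

lemma integrable_rpow_of_le {Ω : Type*} [MeasurableSpace Ω] {μ : Measure Ω} [IsFiniteMeasure μ]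
    {Y : Ω → ℝ} (hY : Measurable Y) (hYpos : ∀ ω, 0 < Y ω) {α β : ℝ} (hα : 0 ≤ α) (hαβ : α ≤ β)
    (hint : Integrable (fun ω => Y ω ^ β) μ) : Integrable (fun ω => Y ω ^ α) μ := by
  refine ((integrable_const (1 : ℝ)).add hint).mono' (by fun_prop) (ae_of_all _ fun ω => ?_)
  have h := hYpos ω
  rw [Real.norm_of_nonneg (by positivity), Pi.add_apply]
  rcases le_total (Y ω) 1 with h1 | h1
  · have := Real.rpow_le_one h.le h1 hα
    have : 0 ≤ Y ω ^ β := by positivity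
    linarith
  · have := Real.rpow_le_rpow_of_exponent_le h1 hαβ
    linarith

/-- Breiman's lemma, with tails compared to a regularly varying function. -/
lemma tendsto_measureReal_mul_gt_div {Ω : Type*} [MeasurableSpace Ω] {μ : Measure Ω}
    [IsProbabilityMeasure μ] {F : ℝ → ℝ} (hF : Antitone F) (hpos : ∀ t, 0 < F t)
    (hF1 : ∀ t, F t ≤ 1) {α β : ℝ} (hα : 0 ≤ α) (hβ : α < β)
    (hreg : ∀ x, 0 < x → Tendsto (fun t => F (t * x) / F t) atTop (nhds (x ^ (-α))))
    {Y Z : Ω → ℝ} (hY : Measurable Y) (hZ : Measurable Z)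
    (hYpos : ∀ ω, 0 < Y ω) (hind : IndepFun Y Z μ) (hint : Integrable (fun ω => Y ω ^ β) μ)
    {c : ℝ} (hG : Tendsto (fun t => μ.real {ω | Z ω > t} / F t) atTop (nhds c)) :
    Tendsto (fun t => μ.real {ω | Y ω * Z ω > t} / F t) atTop
      (nhds (c * ∫ ω, Y ω ^ α ∂μ)) := by
  obtain ⟨K, hK, hpotter⟩ := exists_potter_bound hF hpos hF1 (hα.trans hβ.le) hβ
    (hreg 2⁻¹ (by norm_num))
  have hGanti := antitone_measureReal_gt μ Z
  set G : ℝ → ℝ := fun t => μ.real {ω | Z ω > t}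
  have hG0 (t : ℝ) : 0 ≤ G t := measureReal_nonneg
  have hG1 (t : ℝ) : G t ≤ 1 := measureReal_le_one
  obtain ⟨M, hM, hGM⟩ : ∃ M, 0 ≤ M ∧ ∀ s, G s ≤ M * F s := by
    obtain ⟨s₀, hs₀⟩ := eventually_atTop.1 (hG.eventually (gt_mem_nhds (lt_add_one c)))
    refine ⟨max (c + 1) (1 / F s₀), le_max_of_le_right (by have := hpos s₀; positivity),
      fun s => ?_⟩
    have := hpos s
    rcases le_total s₀ s with h | h
    · calc G s ≤ (c + 1) * F s := by
            rw [← div_le_iff₀ (hpos s)]; exact (hs₀ s h).le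
        _ ≤ _ := by gcongr; exact le_max_left _ _
    · calc G s ≤ 1 := hG1 s
        _ ≤ 1 / F s₀ * F s := by
          rw [div_mul_eq_mul_div, one_mul, one_le_div (hpos _)]; exact hF h
        _ ≤ _ := by gcongr; exact le_max_right _ _
  have heq (t : ℝ) : μ.real {ω | Y ω * Z ω > t} / F t = ∫ ω, G (t / Y ω) / F t ∂μ := by
    rw [measureReal_mul_gt_eq_integral hY hZ hYpos hind, integral_div]
  simp_rw [heq, ← integral_const_mul]
  refine tendsto_integral_filter_of_dominated_convergence
    (fun ω => M * (K * (1 + Y ω ^ β))) ?_ ?_ ?_ ?_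
  · exact .of_forall fun t =>
      ((hGanti.measurable.comp (measurable_const.div hY)).div_const _).aestronglyMeasurable
  · filter_upwards [hpotter] with t ht
    refine ae_of_all _ fun ω => ?_
    rw [Real.norm_of_nonneg (div_nonneg (hG0 _) (hpos t).le), div_le_iff₀ (hpos t), mul_assoc]
    exact (hGM _).trans (mul_le_mul_of_nonneg_left (ht _ (hYpos ω)) hM)
  · exact (((integrable_const (1 : ℝ)).add hint).const_mul K).const_mul M
  · refine ae_of_all _ fun ω => ?_
    have hy := hYpos ω
    have h1 : Tendsto (fun t : ℝ => t / Y ω) atTop atTop := tendsto_id.atTop_div_const hy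
    have h2 := hreg (Y ω)⁻¹ (inv_pos.2 hy)
    rw [Real.inv_rpow hy.le, Real.rpow_neg hy.le, inv_inv] at h2
    refine ((hG.comp h1).mul h2).congr fun t => ?_
    have := (hpos (t / Y ω)).ne'
    simp only [Function.comp, ← div_eq_mul_inv]
    exact div_mul_div_cancel₀ this

/-- Asymptotically, the probability of a finite union of events whose pairwise intersections
are negligible is the sum of the probabilities. -/
lemma tendsto_measureReal_biUnion_div {Ω ι : Type*} [MeasurableSpace Ω] [DecidableEq ι]
    {μ : Measure Ω} [IsFiniteMeasure μ] {A : ι → ℝ → Set Ω} (hA : ∀ i t, MeasurableSet (A i t))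
    {F : ℝ → ℝ} (hpos : ∀ t, 0 < F t) {c : ι → ℝ}
    (hc : ∀ i, Tendsto (fun t => μ.real (A i t) / F t) atTop (nhds (c i)))
    (hpair : ∀ i j, i ≠ j → Tendsto (fun t => μ.real (A i t ∩ A j t) / F t) atTop (nhds 0))
    (s : Finset ι) :
    Tendsto (fun t => μ.real (⋃ i ∈ s, A i t) / F t) atTop (nhds (∑ i ∈ s, c i)) := by
  induction s using Finset.induction_on with
  | empty => simp
  | insert a s ha ih =>
    have hinter : Tendsto (fun t => μ.real (A a t ∩ ⋃ i ∈ s, A i t) / F t) atTop (nhds 0) := by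
      refine squeeze_zero (fun t => div_nonneg measureReal_nonneg (hpos t).le)
        (g := fun t => ∑ i ∈ s, μ.real (A a t ∩ A i t) / F t) (fun t => ?_) ?_
      · rw [← Finset.sum_div, Set.inter_iUnion₂]
        exact div_le_div_of_nonneg_right (measureReal_biUnion_finset_le _ _) (hpos t).le
      · rw [← Finset.sum_const_zero (s := s)]
        exact tendsto_finsetSum _ fun i hi => hpair a i fun h => ha (h ▸ hi)
    rw [Finset.sum_insert ha]
    have := ((hc a).add ih).sub hinter
    rw [sub_zero] at this
    refine this.congr fun t => ?_
    rw [Finset.set_biUnion_insert, ← add_div, ← sub_div,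
      ← measureReal_union_add_inter (s.measurableSet_biUnion fun i _ => hA i t) (measure_ne_top _ _)
        (measure_ne_top _ _),
      add_sub_cancel_right]

/-- A perturbation with negligible tail does not affect the tail asymptotics. -/
lemma tendsto_measureReal_gt_div_of_abs_sub_le {Ω : Type*} [MeasurableSpace Ω] {μ : Measure Ω}
    [IsFiniteMeasure μ] {F : ℝ → ℝ} (hpos : ∀ t, 0 < F t) {α : ℝ}
    (hreg : ∀ x, 0 < x → Tendsto (fun t => F (t * x) / F t) atTop (nhds (x ^ (-α))))
    {S U V : Ω → ℝ} (hSU : ∀ ω, |S ω - U ω| ≤ V ω) {a : ℝ}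
    (hU : Tendsto (fun t => μ.real {ω | U ω > t} / F t) atTop (nhds a))
    (hV : Tendsto (fun t => μ.real {ω | V ω > t} / F t) atTop (nhds 0)) :
    Tendsto (fun t => μ.real {ω | S ω > t} / F t) atTop (nhds a) := by
  have hscale {W : Ω → ℝ} {c x : ℝ} (hx : 0 < x)
      (hW : Tendsto (fun t => μ.real {ω | W ω > t} / F t) atTop (nhds c)) :
      Tendsto (fun t => μ.real {ω | W ω > t * x} / F t) atTop (nhds (c * x ^ (-α))) := by
    refine ((hW.comp (tendsto_id.atTop_mul_const hx)).mul (hreg x hx)).congr fun t => ?_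
    have := (hpos (t * x)).ne'
    simp only [Function.comp, id]
    field_simp
  have hcont : Tendsto (fun x : ℝ => a * x ^ (-α)) (nhds 1) (nhds a) := by
    have : ContinuousAt (fun x : ℝ => a * x ^ (-α)) 1 :=
      continuousAt_const.mul (Real.continuousAt_rpow_const _ _ (Or.inl one_ne_zero))
    simpa [ContinuousAt] using this
  refine tendsto_order.2 ⟨fun b hb => ?_, fun b hb => ?_⟩
  · obtain ⟨x, hbx, hx⟩ := (((hcont.eventually (lt_mem_nhds hb)).filter_mono
      nhdsWithin_le_nhds).and (self_mem_nhdsWithin : Set.Ioi (1 : ℝ) ∈ nhdsWithin 1 _)).exists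
    have hx : 1 < x := hx
    have hlim := (hscale (by linarith) hU).sub (hscale (sub_pos.2 hx) hV)
    rw [zero_mul, sub_zero] at hlim
    filter_upwards [hlim.eventually (lt_mem_nhds hbx)] with t ht
    refine ht.trans_le ?_
    rw [← sub_div]
    refine div_le_div_of_nonneg_right ?_ (hpos t).le
    rw [sub_le_iff_le_add]
    refine (measureReal_mono fun ω hω => ?_).trans (measureReal_union_le _ _)
    simp only [Set.mem_ofPred_eq, Set.mem_union] at hω ⊢
    by_contra! hcon
    have := abs_le.1 (hSU ω)
    nlinarith
  · obtain ⟨x, hbx, hx0, hx⟩ := (((hcont.eventually (gt_mem_nhds hb)).filter_mono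
      nhdsWithin_le_nhds).and (Ioo_mem_nhdsLT (zero_lt_one' ℝ))).exists
    have hlim := (hscale hx0 hU).add (hscale (sub_pos.2 hx) hV)
    rw [zero_mul, add_zero] at hlim
    filter_upwards [hlim.eventually (gt_mem_nhds hbx)] with t ht
    refine lt_of_le_of_lt ?_ ht
    rw [← add_div]
    refine div_le_div_of_nonneg_right ?_ (hpos t).le
    refine (measureReal_mono fun ω hω => ?_).trans (measureReal_union_le _ _)
    simp only [Set.mem_ofPred_eq, Set.mem_union] at hω ⊢
    by_contra! hcon
    have := abs_le.1 (hSU ω)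
    nlinarith

/-- Theorem 2 (weights independent of the risks): tail asymptotics of a randomly
weighted sum of the top `k` order statistics, regular variation index `α ≥ 0`. -/
theorem randomly_weighted_order_statistics_independent_weights
    {Ω : Type*} [MeasureSpace Ω] [IsProbabilityMeasure (ℙ : Measure Ω)]
    (n k : ℕ) (hk : 1 ≤ k) (hkn : k ≤ n + 1)
    (X : Fin (n + 1) → Ω → ℝ) (hXmeas : ∀ i, Measurable (X i))
    (hXpos : ∀ i ω, 0 < X i ω)
    (α : ℝ) (hα : 0 ≤ α)
    (hreg : ∀ x : ℝ, 0 < x →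
      Tendsto (fun t : ℝ =>
        (ℙ {ω | X 0 ω > t * x}).toReal / (ℙ {ω | X 0 ω > t}).toReal) atTop (nhds (x ^ (-α))))
    (lam : Fin (n + 1) → ℝ) (hlam_nonneg : ∀ i, 0 ≤ lam i) (hlam0 : lam 0 = 1)
    (hlam : ∀ i, Tendsto (fun t : ℝ =>
        (ℙ {ω | X i ω > t}).toReal / (ℙ {ω | X 0 ω > t}).toReal) atTop (nhds (lam i)))
    (hjoint : ∀ i j : Fin (n + 1), i < j → 0 < lam i → 0 < lam j →
      Tendsto (fun t : ℝ =>
        (ℙ {ω | X i ω > t ∧ X j ω > t}).toReal / (ℙ {ω | X 0 ω > t}).toReal) atTop (nhds 0))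
    (C : Fin (n + 1) → Ω → ℝ) (hCmeas : ∀ i, Measurable (C i))
    (hC1pos : ∀ ω, 0 < C 0 ω)
    (hindep : IndepFun (fun ω i => C i ω) (fun ω i => X i ω) ℙ)
    (β : ℝ) (hβ : α < β)
    (hmom : Integrable (fun ω => C 0 ω ^ β) ℙ)
    (Ct : Ω → ℝ) (hCt : ∀ ω, Ct ω = ⨆ i : Fin (n + 1), if i = 0 then 0 else |C i ω|)
    (γ : ℝ) (hγ : α < γ)
    (hCtmom : Integrable (fun ω => Ct ω ^ γ) ℙ)
    (hCtpos : 0 < ∫ ω, Ct ω ^ γ ∂ℙ) :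
    Tendsto (fun t : ℝ =>
        (ℙ {ω | ∑ i ∈ Finset.univ.filter (fun i : Fin (n + 1) => (i : ℕ) < k),
            C i ω * orderStat X i ω > t}).toReal /
          (ℙ {ω | C 0 ω * orderStat X 0 ω > t}).toReal) atTop (nhds 1) ∧
    Tendsto (fun t : ℝ =>
        (ℙ {ω | C 0 ω * orderStat X 0 ω > t}).toReal /
          ((∫ ω, C 0 ω ^ α ∂ℙ) * (∑ i, lam i) * (ℙ {ω | X 0 ω > t}).toReal))
      atTop (nhds 1) := by
  set F : ℝ → ℝ := fun t => (ℙ : Measure Ω).real {ω | X 0 ω > t}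
  have hF : Antitone F := antitone_measureReal_gt _ _
  have hF1 (t : ℝ) : F t ≤ 1 := measureReal_le_one
  have hpos : ∀ t, 0 < F t := by
    have h1 : Tendsto (fun t => F (t * 1) / F t) atTop (nhds 1) := by
      have h := hreg 1 one_pos
      rwa [Real.one_rpow] at h
    intro t
    obtain ⟨s, hs, hts⟩ := ((h1.eventually (lt_mem_nhds one_pos)).and
      (eventually_ge_atTop t)).exists
    refine lt_of_lt_of_le (lt_of_le_of_ne measureReal_nonneg fun h => ?_) (hF hts)
    have h : F s = 0 := h.symm
    simp [h] at hs
  have hpair (i j : Fin (n + 1)) (hij : i ≠ j) : Tendsto (fun t =>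
      (ℙ : Measure Ω).real ({ω | X i ω > t} ∩ {ω | X j ω > t}) / F t) atTop (nhds 0) := by
    have hzero (i j : Fin (n + 1)) (hi : lam i = 0) : Tendsto (fun t =>
        (ℙ : Measure Ω).real ({ω | X i ω > t} ∩ {ω | X j ω > t}) / F t) atTop (nhds 0) :=
      squeeze_zero (fun t => div_nonneg measureReal_nonneg (hpos t).le)
        (fun t => div_le_div_of_nonneg_right (measureReal_mono Set.inter_subset_left) (hpos t).le)
        (hi ▸ hlam i)
    rcases (hlam_nonneg i).eq_or_lt with hi | hi
    · exact hzero i j hi.symm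
    rcases (hlam_nonneg j).eq_or_lt with hj | hj
    · simpa only [Set.inter_comm] using hzero j i hj.symm
    rcases lt_or_gt_of_ne hij with h | h
    · exact hjoint i j h hi hj
    · simp_rw [Set.inter_comm {ω | X i ω > _}]
      exact hjoint j i h hj hi
  have hmax : Tendsto (fun t => (ℙ : Measure Ω).real {ω | orderStat X 0 ω > t} / F t) atTop
      (nhds (∑ i, lam i)) := by
    refine (tendsto_measureReal_biUnion_div (A := fun i t => {ω | X i ω > t})
      (fun i t => measurableSet_lt measurable_const (hXmeas i)) hpos hlam hpair
      Finset.univ).congr fun t => ?_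
    congr 2
    ext ω
    simp only [Finset.mem_univ, Set.iUnion_true, Set.mem_iUnion, Set.mem_ofPred_eq, gt_iff_lt,
      orderStat_zero]
    exact (lt_ciSup_iff (Finite.bddAbove_range _)).symm
  have hsecond : Tendsto (fun t => (ℙ : Measure Ω).real {ω | pairMax X ω > t} / F t) atTop
      (nhds 0) := by
    set P : Finset (Fin (n + 1) × Fin (n + 1)) := Finset.univ.filter fun p => p.1 < p.2
    have hlim : Tendsto (fun t => ∑ p ∈ P,
        (ℙ : Measure Ω).real ({ω | X p.1 ω > t} ∩ {ω | X p.2 ω > t}) / F t) atTop (nhds 0) := by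
      rw [← Finset.sum_const_zero (s := P)]
      exact tendsto_finsetSum _ fun p hp => hpair _ _ (Finset.mem_filter.1 hp).2.ne
    refine squeeze_zero' (.of_forall fun t => div_nonneg measureReal_nonneg (hpos t).le) ?_ hlim
    filter_upwards [eventually_ge_atTop 0] with t ht
    rw [← Finset.sum_div]
    refine div_le_div_of_nonneg_right ?_ (hpos t).le
    refine (measureReal_mono (fun ω hω => ?_) (measure_ne_top _ _)).trans
      (measureReal_biUnion_finset_le _ _)
    obtain ⟨i, j, hij, hi, hj⟩ := exists_lt_of_lt_pairMax X ht hω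
    exact Set.mem_biUnion (x := (i, j)) (by simpa [P] using hij) ⟨hi, hj⟩
  have hCt0 (ω : Ω) : 0 ≤ Ct ω := by
    rw [hCt]
    simpa using Finite.le_ciSup (fun i : Fin (n + 1) => if i = 0 then 0 else |C i ω|) 0
  have hCle (i : Fin (n + 1)) (hi : i ≠ 0) (ω : Ω) : |C i ω| ≤ Ct ω := by
    rw [hCt]
    simpa [hi] using Finite.le_ciSup (fun i : Fin (n + 1) => if i = 0 then 0 else |C i ω|) i
  set wt : (Fin (n + 1) → ℝ) → ℝ := fun c =>
    (n + 1) * ((⨆ i : Fin (n + 1), if i = 0 then 0 else |c i|) + 1)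
  have hwt : Measurable wt := by
    refine ((Measurable.iSup fun i => ?_).add_const 1).const_mul _
    split_ifs
    · exact measurable_const
    · fun_prop
  set D : Ω → ℝ := fun ω => (n + 1) * (Ct ω + 1)
  have hDwt : D = wt ∘ fun ω i => C i ω := by
    ext ω
    simp only [D, wt, hCt, Function.comp]
  have hDmeas : Measurable D := hDwt ▸ hwt.comp (measurable_pi_lambda _ hCmeas)
  have hDpos (ω : Ω) : 0 < D ω := by
    have := hCt0 ω
    positivity
  have hCtmeas : Measurable Ct := by
    have : Ct = fun ω => D ω / (n + 1) - 1 := by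
      ext ω
      have : (n : ℝ) + 1 ≠ 0 := by positivity
      simp only [D]
      field_simp
      ring
    rw [this]
    fun_prop
  have hDint : Integrable (fun ω => D ω ^ γ) ℙ := by
    have hγ0 : 0 ≤ γ := hα.trans hγ.le
    refine (((hCtmom.add (integrable_const (1 : ℝ))).const_mul (2 ^ γ)).const_mul
      (((n : ℝ) + 1) ^ γ)).mono' (by fun_prop) (ae_of_all _ fun ω => ?_)
    have h0 := hCt0 ω
    have hp : 0 ≤ Ct ω ^ γ := by positivity
    rw [Real.norm_of_nonneg (by have := hDpos ω; positivity), Pi.add_apply]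
    simp only [D]
    rw [Real.mul_rpow (by positivity) (by positivity)]
    gcongr
    rcases le_total (Ct ω) 1 with h | h
    · calc (Ct ω + 1) ^ γ ≤ 2 ^ γ := by gcongr; linarith
        _ ≤ 2 ^ γ * (Ct ω ^ γ + 1) := le_mul_of_one_le_right (by positivity) (by linarith)
    · calc (Ct ω + 1) ^ γ ≤ (2 * Ct ω) ^ γ := by gcongr; linarith
        _ = 2 ^ γ * Ct ω ^ γ := Real.mul_rpow (by norm_num) h0
        _ ≤ 2 ^ γ * (Ct ω ^ γ + 1) := by gcongr; linarith
  have hmaxfun : orderStat X 0 = (fun x : Fin (n + 1) → ℝ => ⨆ i, x i) ∘ fun ω i => X i ω :=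
    funext fun ω => orderStat_zero X ω
  have hsupmeas : Measurable fun x : Fin (n + 1) → ℝ => ⨆ i, x i :=
    Measurable.iSup fun i => measurable_pi_apply i
  have hindC : IndepFun (C 0) (orderStat X 0) ℙ := by
    rw [hmaxfun]
    exact hindep.comp (φ := fun c : Fin (n + 1) → ℝ => c 0) (measurable_pi_apply 0) hsupmeas
  have hindD : IndepFun D (pairMax X) ℙ := by
    rw [hDwt]
    exact hindep.comp (ψ := pairMax fun i (x : Fin (n + 1) → ℝ) => x i) hwt
      (measurable_pairMax measurable_pi_apply)
  have hmaxmeas : Measurable (orderStat X 0) :=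
    hmaxfun ▸ hsupmeas.comp (measurable_pi_lambda _ hXmeas)
  have hU := tendsto_measureReal_mul_gt_div hF hpos hF1 hα hβ hreg (hCmeas 0) hmaxmeas hC1pos
    hindC hmom hmax
  have hV := tendsto_measureReal_mul_gt_div hF hpos hF1 hα hγ hreg hDmeas
    (measurable_pairMax hXmeas) hDpos hindD hDint hsecond
  rw [zero_mul] at hV
  have hpair0 (ω : Ω) : 0 ≤ pairMax X ω := by
    simpa [pairMax] using Finite.le_ciSup (fun p : Fin (n + 1) × Fin (n + 1) =>
      if p.1 < p.2 then min (X p.1 ω) (X p.2 ω) else 0) (0, 0)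
  have hdiff (ω : Ω) : |∑ i ∈ Finset.univ.filter (fun i : Fin (n + 1) => (i : ℕ) < k),
      C i ω * orderStat X i ω - C 0 ω * orderStat X 0 ω| ≤ D ω * pairMax X ω := by
    have h0 : (0 : Fin (n + 1)) ∈
        Finset.univ.filter (fun i : Fin (n + 1) => (i : ℕ) < k) := by
      simpa using Nat.succ_le_iff.1 hk
    have hW := hpair0 ω
    have hc := hCt0 ω
    rw [← Finset.add_sum_erase _ _ h0, add_sub_cancel_left]
    set s := (Finset.univ.filter (fun i : Fin (n + 1) => (i : ℕ) < k)).erase 0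
    have hcard : (s.card : ℝ) ≤ n + 1 := by
      exact_mod_cast (Finset.card_le_univ s).trans_eq (Fintype.card_fin _)
    calc |∑ i ∈ s, C i ω * orderStat X i ω| ≤ ∑ i ∈ s, |C i ω * orderStat X i ω| :=
          Finset.abs_sum_le_sum_abs _ _
      _ ≤ ∑ _i ∈ s, Ct ω * pairMax X ω := by
        refine Finset.sum_le_sum fun i hi => ?_
        have hi0 := Finset.ne_of_mem_erase hi
        have hXi : 0 < orderStat X i ω := by
          obtain ⟨σ, hσ, -⟩ := exists_perm_orderStat X ω
          exact hσ i ▸ hXpos _ _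
        rw [abs_mul, abs_of_pos hXi]
        exact mul_le_mul (hCle i hi0 ω) (orderStat_le_pairMax X ω hi0) hXi.le hc
      _ = s.card * (Ct ω * pairMax X ω) := by rw [Finset.sum_const, nsmul_eq_mul]
      _ ≤ (n + 1) * ((Ct ω + 1) * pairMax X ω) := by gcongr; linarith
      _ = D ω * pairMax X ω := by simp only [D]; ring
  have hS := tendsto_measureReal_gt_div_of_abs_sub_le hpos hreg hdiff hU hV
  have hEpos : 0 < ∫ ω, C 0 ω ^ α ∂ℙ := by
    rw [integral_pos_iff_support_of_nonneg (fun ω => Real.rpow_nonneg (hC1pos ω).le _)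
      (integrable_rpow_of_le (hCmeas 0) hC1pos hα hβ.le hmom)]
    have : Function.support (fun ω => C 0 ω ^ α) = Set.univ :=
      Set.eq_univ_of_forall fun ω => (Real.rpow_pos_of_pos (hC1pos ω) _).ne'
    simp [this]
  have hlampos : 0 < ∑ i, lam i :=
    Finset.sum_pos' (fun i _ => hlam_nonneg i) ⟨0, Finset.mem_univ _, by simp [hlam0]⟩
  have hlim := (mul_pos hlampos hEpos).ne'
  constructor
  · refine ((div_self hlim) ▸ hS.div hU hlim).congr fun t => ?_
    exact div_div_div_cancel_right₀ (hpos t).ne' _ _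
  · refine ((div_self hlim) ▸ hU.div_const _).congr fun t => ?_
    rw [div_div, mul_comm (∑ i, lam i), mul_comm (F t)]
    rfl
end

section
/- Let C_1 and X_1 be independent positive random variables. Suppose X_1 has distribution function in the Gumbel max-domain of attraction with infinite right endpoint and auxiliary function a(·), and C_1 satisfies Model A with upper endpoint ω ∈ (0,∞): P(C_1=ω)=p ∈ (0,1] and P(C_1≤η)=1−p for some η ∈ (0,ω). Then P(C_1X_1 > tω) = p·P(X_1>t)·(1 + R(t)) where R(t)=o((a(t)/t)^ξ) as t→∞ for every ξ>0; in particular P(C_1X_1 > tω) ~ p·P(X_1>t) as t→∞. -/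
open MeasureTheory ProbabilityTheory Filter Real

/-- Any auxiliary function of a Gumbel tail grows by a factor of at most `b > 1` along one step
`t ↦ t + a t`, eventually. -/
lemma eventually_auxiliary_step_le {G a : ℝ → ℝ} (hG : Antitone G) (hGpos : ∀ t, 0 < G t)
    (ha : ∀ t, 0 < a t)
    (hlim : ∀ x : ℝ, Tendsto (fun t => G (t + a t * x) / G t) atTop (nhds (exp (-x))))
    {b : ℝ} (hb : 1 < b) : ∀ᶠ t in atTop, a (t + a t) ≤ b * a t := by
  have hs : Tendsto (fun t => t + a t) atTop atTop :=
    tendsto_atTop_mono (fun t => le_add_of_nonneg_right (ha t).le) tendsto_id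
  have h1 : Tendsto (fun t => G (t + a t) / G t) atTop (nhds (exp (-1))) := by
    simpa using hlim 1
  have h2 : Tendsto (fun t => G (t + a t + a (t + a t)) / G (t + a t)) atTop
      (nhds (exp (-1))) := by
    simpa [Function.comp_def] using (hlim 1).comp hs
  have h3 : Tendsto (fun t => G (t + a t + a (t + a t)) / G t) atTop (nhds (exp (-2))) := by
    have h := h2.mul h1
    rw [← exp_add, show (-1 + -1 : ℝ) = -2 by norm_num] at h
    exact h.congr fun t => div_mul_div_cancel₀ (hGpos (t + a t)).ne'
  have hlt : exp (-(1 + b)) < exp (-2) := exp_lt_exp.2 (by linarith)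
  filter_upwards [(hlim (1 + b)).eventually_lt h3 hlt] with t ht
  by_contra! hcon
  refine absurd ht (not_lt.2 ?_)
  exact div_le_div_of_nonneg_right (hG (by nlinarith)) (hGpos t).le

/-- A function that at least halves along `t ↦ t + a t`, where `a` grows by a factor of at most
`b`, decays geometrically at geometrically growing distances. -/
lemma tail_le_of_step {G a : ℝ → ℝ} (hG : Antitone G) (ha : ∀ t, 0 < a t) {b T : ℝ} (hb : 1 < b)
    (hstep : ∀ t, T ≤ t → a (t + a t) ≤ b * a t)
    (hhalf : ∀ t, T ≤ t → G (t + a t) ≤ 2⁻¹ * G t) (n : ℕ) :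
    ∀ t, T ≤ t → G (t + a t * ((b ^ n - 1) / (b - 1))) ≤ (2 ^ n)⁻¹ * G t := by
  have hb' : 0 < b - 1 := by linarith
  induction n with
  | zero => simp
  | succ n ih =>
    intro t ht
    have hq : 0 ≤ (b ^ n - 1) / (b - 1) :=
      div_nonneg (by linarith [one_le_pow₀ hb.le (n := n)]) hb'.le
    have hle : t + a t + a (t + a t) * ((b ^ n - 1) / (b - 1))
        ≤ t + a t * ((b ^ (n + 1) - 1) / (b - 1)) := by
      calc _ ≤ t + a t + b * a t * ((b ^ n - 1) / (b - 1)) := by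
            gcongr
            exact hstep t ht
        _ = _ := by field_simp; ring
    calc _ ≤ G (t + a t + a (t + a t) * ((b ^ n - 1) / (b - 1))) := hG hle
      _ ≤ (2 ^ n)⁻¹ * G (t + a t) := ih _ (by linarith [ha t])
      _ ≤ (2 ^ n)⁻¹ * (2⁻¹ * G t) := by
        gcongr
        exact hhalf t ht
      _ = _ := by rw [pow_succ, mul_inv]; ring

/-- A Gumbel tail with auxiliary function `a` satisfies `G (l t) / G t = O((a t / t) ^ k)` for all
`l > 1` and `k > 0`. -/
lemma exists_tail_ratio_le {G a : ℝ → ℝ} (hG : Antitone G) (hGpos : ∀ t, 0 < G t)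
    (ha : ∀ t, 0 < a t) (ha_small : Tendsto (fun t => a t / t) atTop (nhds 0))
    (hlim : ∀ x : ℝ, Tendsto (fun t => G (t + a t * x) / G t) atTop (nhds (exp (-x))))
    {l k : ℝ} (hl : 1 < l) (hk : 0 < k) :
    ∃ K : ℝ, ∀ᶠ t in atTop, G (l * t) / G t ≤ K * (a t / t) ^ k := by
  obtain ⟨b, hb, hbk⟩ : ∃ b : ℝ, 1 < b ∧ b ^ k = 2 :=
    ⟨2 ^ k⁻¹, one_lt_rpow (by norm_num) (by positivity), rpow_inv_rpow (by norm_num) hk.ne'⟩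
  have hb' : 0 < b - 1 := by linarith
  have hb0 : 0 < b := by linarith
  have hl' : 0 < l - 1 := by linarith
  have hhalf : ∀ᶠ t in atTop, G (t + a t) ≤ 2⁻¹ * G t := by
    have h1 : Tendsto (fun t => G (t + a t) / G t) atTop (nhds (exp (-1))) := by
      simpa using hlim 1
    have hlt : exp (-1) < 2⁻¹ := by
      rw [exp_neg]
      exact inv_strictAnti₀ (by norm_num) (by linarith [exp_one_gt_d9])
    filter_upwards [h1.eventually_lt_const hlt] with t ht
    exact ((div_lt_iff₀ (hGpos t)).1 ht).le
  obtain ⟨T, hT⟩ := eventually_atTop.1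
    ((eventually_auxiliary_step_le hG hGpos ha hlim hb).and hhalf)
  set c : ℝ := (b - 1) * (l - 1) with hc
  have hc0 : 0 < c := mul_pos hb' hl'
  refine ⟨(b / c) ^ k, ?_⟩
  filter_upwards [eventually_ge_atTop T, eventually_gt_atTop 0,
    ha_small.eventually_lt_const hc0] with t htT ht0 htc
  have hat := ha t
  have hu : 1 ≤ c / (a t / t) := (one_le_div (by positivity)).2 htc.le
  obtain ⟨n, hn1, hn2⟩ := exists_nat_pow_near hu hb
  have hdist : t + a t * ((b ^ n - 1) / (b - 1)) ≤ l * t := by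
    have h1 : a t * b ^ n ≤ c * t := by
      rw [le_div_iff₀ (by positivity)] at hn1
      rw [← mul_div_assoc, div_le_iff₀ ht0] at hn1
      linarith
    have h2 : a t * ((b ^ n - 1) / (b - 1)) ≤ (l - 1) * t := by
      rw [← mul_div_assoc, div_le_iff₀ hb']
      rw [hc] at h1
      linarith
    linarith
  rw [div_le_iff₀ (hGpos t)]
  refine (hG hdist).trans <|
    (tail_le_of_step hG ha hb (fun t ht => (hT t ht).1) (fun t ht => (hT t ht).2) n t htT).trans ?_
  refine mul_le_mul_of_nonneg_right ?_ (hGpos t).le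
  rw [← mul_rpow (by positivity) (by positivity), ← hbk, ← rpow_natCast, ← rpow_mul hb0.le,
    mul_comm, rpow_mul hb0.le, rpow_natCast, ← inv_rpow (by positivity)]
  refine rpow_le_rpow (by positivity) ?_ hk.le
  rw [inv_le_iff_one_le_mul₀ (by positivity)]
  rw [div_lt_iff₀ (by positivity), pow_succ] at hn2
  rw [div_mul_eq_mul_div, div_mul_eq_mul_div, one_le_div hc0]
  linarith

/-- A Gumbel tail with auxiliary function `a` satisfies `G (l t) / G t = o((a t / t) ^ ξ)` for all
`l > 1` and `ξ > 0`. -/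
lemma tendsto_tail_ratio_div_rpow {G a : ℝ → ℝ} (hG : Antitone G) (hGpos : ∀ t, 0 < G t)
    (ha : ∀ t, 0 < a t) (ha_small : Tendsto (fun t => a t / t) atTop (nhds 0))
    (hlim : ∀ x : ℝ, Tendsto (fun t => G (t + a t * x) / G t) atTop (nhds (exp (-x))))
    {l ξ : ℝ} (hl : 1 < l) (hξ : 0 < ξ) :
    Tendsto (fun t => G (l * t) / G t / (a t / t) ^ ξ) atTop (nhds 0) := by
  obtain ⟨K, hK⟩ := exists_tail_ratio_le hG hGpos ha ha_small hlim hl (k := ξ + 1) (by linarith)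
  have hbound : Tendsto (fun t => K * (a t / t)) atTop (nhds 0) := by
    simpa using ha_small.const_mul K
  refine tendsto_of_tendsto_of_tendsto_of_le_of_le' tendsto_const_nhds hbound ?_ ?_
  · filter_upwards [eventually_gt_atTop 0] with t ht
    have := hGpos (l * t)
    have := hGpos t
    have := ha t
    positivity
  · filter_upwards [hK, eventually_gt_atTop 0] with t ht ht0
    have hat : 0 < a t / t := div_pos (ha t) ht0
    rw [div_le_iff₀ (rpow_pos_of_pos hat ξ), mul_assoc]
    rwa [rpow_add_one hat.ne', mul_comm (_ ^ ξ)] at ht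

/-- Bounds on the tail of a product `C * X` of independent factors, where `C` equals `w` with
probability `p` and is otherwise at most `η`. -/
lemma product_tail_bounds {Ω : Type*} [MeasurableSpace Ω] {μ : Measure Ω} [IsProbabilityMeasure μ]
    {C X : Ω → ℝ} (hC : Measurable C) (hXpos : ∀ ω, 0 < X ω)
    (hindep : IndepFun C X μ) {w p η : ℝ} (hw : 0 < w) (hη0 : 0 < η) (hη1 : η < w)
    (hpw : μ.real {ω | C ω = w} = p) (hpη : μ.real {ω | C ω ≤ η} = 1 - p) (t : ℝ) :
    p * μ.real {ω | X ω > t} ≤ μ.real {ω | C ω * X ω > t * w} ∧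
      μ.real {ω | C ω * X ω > t * w}
        ≤ p * μ.real {ω | X ω > t} + (1 - p) * μ.real {ω | X ω > w / η * t} := by
  have hmul : ∀ (A : Set ℝ) (s : ℝ), MeasurableSet A →
      μ.real (C ⁻¹' A ∩ {ω | X ω > s}) = μ.real (C ⁻¹' A) * μ.real {ω | X ω > s} := by
    intro A s hA
    have h : μ.real (C ⁻¹' A ∩ X ⁻¹' Set.Ioi s) = μ.real (C ⁻¹' A) * μ.real (X ⁻¹' Set.Ioi s) := by
      simpa [Measure.real] using congrArg ENNReal.toReal
        (hindep.measure_inter_preimage_eq_mul A (Set.Ioi s) hA measurableSet_Ioi)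
    exact h
  have hmw := hmul {w} t (measurableSet_singleton w)
  have hmη := hmul (Set.Iic η) (w / η * t) measurableSet_Iic
  rw [show C ⁻¹' {w} = {ω | C ω = w} from rfl] at hmw
  rw [show C ⁻¹' Set.Iic η = {ω | C ω ≤ η} from rfl] at hmη
  have hmeasw : MeasurableSet {ω | C ω = w} := hC (measurableSet_singleton w)
  have hmeasη : MeasurableSet {ω | C ω ≤ η} := hC measurableSet_Iic
  have hdisj : Disjoint {ω | C ω = w} {ω | C ω ≤ η} :=
    Set.disjoint_left.2 fun ω h1 h2 => by
      simp only [Set.mem_ofPred_eq] at h1 h2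
      linarith
  have hnull : μ.real ({ω | C ω = w} ∪ {ω | C ω ≤ η})ᶜ = 0 := by
    rw [probReal_compl_eq_one_sub (hmeasw.union hmeasη), measureReal_union hdisj hmeasη]
    linarith
  rw [hpw] at hmw
  rw [hpη] at hmη
  constructor
  · rw [← hmw]
    refine measureReal_mono fun ω hω => ?_
    obtain ⟨h1, h2⟩ := hω
    simp only [Set.mem_ofPred_eq] at h1 h2 ⊢
    rw [h1]
    nlinarith
  · rw [← hmw, ← hmη]
    have hsub : {ω | C ω * X ω > t * w} ⊆ ({ω | C ω = w} ∩ {ω | X ω > t} ∪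
        {ω | C ω ≤ η} ∩ {ω | X ω > w / η * t}) ∪ ({ω | C ω = w} ∪ {ω | C ω ≤ η})ᶜ := by
      intro ω hω
      simp only [Set.mem_ofPred_eq, Set.mem_union, Set.mem_inter_iff, Set.mem_compl_iff] at hω ⊢
      by_cases h1 : C ω = w
      · rw [h1, mul_comm t] at hω
        exact Or.inl (Or.inl ⟨h1, lt_of_mul_lt_mul_left hω hw.le⟩)
      by_cases h2 : C ω ≤ η
      · refine Or.inl (Or.inr ⟨h2, ?_⟩)
        have := mul_le_mul_of_nonneg_right h2 (hXpos ω).le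
        rw [gt_iff_lt, div_mul_eq_mul_div, div_lt_iff₀ hη0]
        linarith
      · exact Or.inr (by tauto)
    have h1 := measureReal_mono (μ := μ) hsub
    have h2 := measureReal_union_le (μ := μ) ({ω | C ω = w} ∩ {ω | X ω > t} ∪
        {ω | C ω ≤ η} ∩ {ω | X ω > w / η * t}) ({ω | C ω = w} ∪ {ω | C ω ≤ η})ᶜ
    have h3 := measureReal_union_le (μ := μ) ({ω | C ω = w} ∩ {ω | X ω > t})
        ({ω | C ω ≤ η} ∩ {ω | X ω > w / η * t})
    linarith

/-- Lemma (Model A): if `X₁` is in the Gumbel MDA with auxiliary function `a` and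
`C₁` is an independent Model-A scaling with upper endpoint `w`, then
`P(C₁X₁ > tw) = p·P(X₁>t)·(1+R(t))` with `R(t) = o((a(t)/t)^ξ)` for every `ξ>0`;
in particular `P(C₁X₁ > tw) ~ p·P(X₁>t)`. -/
theorem product_tail_gumbel_modelA
    {Ω : Type*} [MeasureSpace Ω] [IsProbabilityMeasure (ℙ : Measure Ω)]
    (C₁ X₁ : Ω → ℝ) (hCmeas : Measurable C₁) (hXmeas : Measurable X₁)
    (hCpos : ∀ ω, 0 < C₁ ω) (hXpos : ∀ ω, 0 < X₁ ω)
    (hindep : IndepFun C₁ X₁ ℙ)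
    -- `X₁` has df in the Gumbel MDA with infinite right endpoint and auxiliary function `a`
    (a : ℝ → ℝ) (ha_meas : Measurable a) (ha_pos : ∀ t, 0 < a t)
    (ha_small : Tendsto (fun t => a t / t) atTop (nhds 0))
    (hinf : ∀ t : ℝ, 0 < (ℙ {ω | X₁ ω > t}).toReal)
    (hGumbel : ∀ x : ℝ, Tendsto (fun t : ℝ =>
        (ℙ {ω | X₁ ω > t + a t * x}).toReal / (ℙ {ω | X₁ ω > t}).toReal)
        atTop (nhds (Real.exp (-x))))
    -- Model A with upper endpoint `w ∈ (0,∞)`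
    (w p η : ℝ) (hw : 0 < w) (hp : 0 < p) (hp1 : p ≤ 1) (hη0 : 0 < η) (hη1 : η < w)
    (hMA1 : (ℙ {ω | C₁ ω = w}).toReal = p)
    (hMA2 : (ℙ {ω | C₁ ω ≤ η}).toReal = 1 - p) :
    ∃ R : ℝ → ℝ,
      (∀ t : ℝ, (ℙ {ω | C₁ ω * X₁ ω > t * w}).toReal
          = p * (ℙ {ω | X₁ ω > t}).toReal * (1 + R t)) ∧
      (∀ ξ : ℝ, 0 < ξ → Tendsto (fun t => R t / (a t / t) ^ ξ) atTop (nhds 0)) ∧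
      Tendsto (fun t : ℝ =>
          (ℙ {ω | C₁ ω * X₁ ω > t * w}).toReal / (p * (ℙ {ω | X₁ ω > t}).toReal))
        atTop (nhds 1) := by
  set G : ℝ → ℝ := fun t => (ℙ {ω | X₁ ω > t}).toReal with hGdef
  set H : ℝ → ℝ := fun t => (ℙ {ω | C₁ ω * X₁ ω > t * w}).toReal with hHdef
  have hG : Antitone G := fun s t hst =>
    measureReal_mono (μ := (ℙ : Measure Ω)) fun ω (hω : t < X₁ ω) => hst.trans_lt hω
  have hbd : ∀ t, p * G t ≤ H t ∧ H t ≤ p * G t + (1 - p) * G (w / η * t) :=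
    product_tail_bounds hCmeas hXpos hindep hw hη0 hη1 hMA1 hMA2
  have hpG : ∀ t, 0 < p * G t := fun t => mul_pos hp (hinf t)
  have hR : ∀ ξ : ℝ, 0 < ξ →
      Tendsto (fun t => (H t / (p * G t) - 1) / (a t / t) ^ ξ) atTop (nhds 0) := by
    intro ξ hξ
    have hlim := (tendsto_tail_ratio_div_rpow hG hinf ha_pos ha_small hGumbel
      ((one_lt_div hη0).2 hη1) hξ).const_mul ((1 - p) / p)
    rw [mul_zero] at hlim
    refine tendsto_of_tendsto_of_tendsto_of_le_of_le' tendsto_const_nhds hlim ?_ ?_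
    · filter_upwards [eventually_gt_atTop 0] with t ht
      have hat : 0 < a t / t := div_pos (ha_pos t) ht
      exact div_nonneg (sub_nonneg.2 ((one_le_div (hpG t)).2 (hbd t).1)) (by positivity)
    · filter_upwards [eventually_gt_atTop 0] with t ht
      have hat : 0 < a t / t := div_pos (ha_pos t) ht
      rw [← mul_div_assoc]
      refine div_le_div_of_nonneg_right ?_ (by positivity)
      rw [div_mul_div_comm, div_sub_one (hpG t).ne']
      exact div_le_div_of_nonneg_right (by linarith [(hbd t).2]) (hpG t).le
  refine ⟨fun t => H t / (p * G t) - 1, fun t => ?_, hR, ?_⟩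
  · change H t = p * G t * (1 + (H t / (p * G t) - 1))
    rw [add_sub_cancel, mul_div_cancel₀ _ (hpG t).ne']
  · have h := ((hR 1 one_pos).mul ha_small).add_const 1
    rw [zero_mul, zero_add] at h
    refine h.congr' ?_
    filter_upwards [eventually_gt_atTop 0] with t ht
    have hat : 0 < a t / t := div_pos (ha_pos t) ht
    rw [rpow_one, div_mul_cancel₀ _ hat.ne', sub_add_cancel]
end

section
/- Let C_1 and X_1 be independent positive random variables. Suppose X_1 has distribution function in the Gumbel max-domain of attraction with infinite right endpoint and auxiliary function a(·), and C_1 has upper endpoint ω ∈ (0,∞) and satisfies Model B: for some γ ∈ [0,∞), lim_{t→∞} P(C_1 > ω − x/t)/P(C_1 > ω − 1/t) = x^γ for every x>0. Then, as t→∞, P(C_1X_1 > tω) ~ Γ(γ+1) · P(C_1 > ω − ω·a(t)/t) · P(X_1>t), where Γ is the Euler gamma function. -/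
open MeasureTheory ProbabilityTheory Filter Real

/-- A crude half of the self-neglecting property of an auxiliary function. -/
lemma eventually_auxiliary_le_two_mul {F a : ℝ → ℝ} (hF : Antitone F) (hFpos : ∀ t, 0 < F t)
    (ha : ∀ t, 0 < a t)
    (hG : ∀ x, Tendsto (fun t => F (t + a t * x) / F t) atTop (nhds (Real.exp (-x))))
    {h : ℝ} (hh : 0 < h) : ∀ᶠ t in atTop, a (t + a t * h) ≤ 2 * a t := by
  have hu : Tendsto (fun t => t + a t * h) atTop atTop :=
    tendsto_atTop_mono (fun t => le_add_of_nonneg_right (mul_pos (ha t) hh).le) tendsto_id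
  have h1 := (hG 1).comp hu
  have h2 : Tendsto (fun t => F (t + a t * (h + 2)) / F (t + a t * h)) atTop
      (nhds (Real.exp (-2))) := by
    have := (hG (h + 2)).div (hG h) (Real.exp_pos _).ne'
    rw [← Real.exp_sub] at this
    refine (this.congr fun t => ?_).trans (le_of_eq (by ring_nf))
    exact div_div_div_cancel_right₀ (hFpos t).ne' _ _
  have e1 := h1.eventually (lt_mem_nhds (show Real.exp (-(3 / 2)) < Real.exp (-1) from
    Real.exp_lt_exp.2 (by norm_num)))
  have e2 := h2.eventually (gt_mem_nhds (show Real.exp (-2) < Real.exp (-(3 / 2)) from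
    Real.exp_lt_exp.2 (by norm_num)))
  filter_upwards [e1, e2] with t q1 q2
  by_contra! hlt
  have q3 := q2.trans q1
  simp only [Function.comp] at q3
  rw [div_lt_div_iff_of_pos_right (hFpos _)] at q3
  exact absurd (hF (show t + a t * (h + 2) ≤ t + a t * h + a (t + a t * h) * 1 by linarith))
    (not_le.2 q3)

/-- The normalised tail decays faster than any power, along dyadic points. -/
lemma exists_eventually_tail_le {F a : ℝ → ℝ} (hF : Antitone F) (hFpos : ∀ t, 0 < F t)
    (ha : ∀ t, 0 < a t)
    (hG : ∀ x, Tendsto (fun t => F (t + a t * x) / F t) atTop (nhds (Real.exp (-x))))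
    {r : ℝ} (hr : 0 < r) :
    ∃ k : ℕ, ∀ᶠ t in atTop, ∀ n : ℕ, F (t + a t * 2 ^ (n + k)) ≤ r ^ n * F t := by
  obtain ⟨k, hk⟩ : ∃ k : ℕ, Real.exp (-(2 ^ k : ℝ)) < r := by
    have : Tendsto (fun k : ℕ => Real.exp (-(2 ^ k : ℝ))) atTop (nhds 0) :=
      Real.tendsto_exp_neg_atTop_nhds_zero.comp (tendsto_pow_atTop_atTop_of_one_lt one_lt_two)
    exact (this.eventually (gt_mem_nhds hr)).exists
  refine ⟨k, ?_⟩
  have hh : (0 : ℝ) < 2 ^ k := by positivity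
  obtain ⟨T, hT⟩ := eventually_atTop.1 ((eventually_auxiliary_le_two_mul hF hFpos ha hG hh).and
    ((hG (2 ^ k)).eventually (gt_mem_nhds hk)))
  have key : ∀ n : ℕ, ∀ t, T ≤ t → F (t + a t * (2 ^ k * (2 ^ n - 1))) ≤ r ^ n * F t := by
    intro n
    induction n with
    | zero => intro t _; simp
    | succ n ih =>
      intro t ht
      obtain ⟨q1, q2⟩ := hT t ht
      rw [div_lt_iff₀ (hFpos t)] at q2
      have h3 := ih (t + a t * 2 ^ k) (by have := mul_pos (ha t) hh; linarith)
      have hn : (0 : ℝ) ≤ 2 ^ n - 1 := by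
        have := one_le_pow₀ (one_le_two : (1 : ℝ) ≤ 2) (n := n); linarith
      have h4 := mul_le_mul_of_nonneg_right q1 (mul_nonneg hh.le hn)
      calc F (t + a t * (2 ^ k * (2 ^ (n + 1) - 1)))
          ≤ F (t + a t * 2 ^ k + a (t + a t * 2 ^ k) * (2 ^ k * (2 ^ n - 1))) :=
            hF (by rw [pow_succ]; nlinarith)
        _ ≤ r ^ n * F (t + a t * 2 ^ k) := h3
        _ ≤ r ^ n * (r * F t) := by gcongr
        _ = r ^ (n + 1) * F t := by ring
  filter_upwards [eventually_ge_atTop T] with t ht n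
  refine (hF ?_).trans (key n t ht)
  have := mul_pos (ha t) hh
  rw [pow_add]
  nlinarith

/-- A Potter-type bound along dyadic multiples. -/
lemma apply_two_pow_mul_le {G : ℝ → ℝ} (hG : Monotone G) (hG1 : ∀ s, G s ≤ 1)
    (hGpos : ∀ s, 0 < s → 0 < G s) {r s₀ : ℝ} (hr : 1 ≤ r) (hs₀ : 0 < s₀)
    (hdouble : ∀ s, 0 < s → s ≤ s₀ → G (2 * s) ≤ r * G s) (n : ℕ) :
    ∀ s, 0 < s → s ≤ s₀ → G (2 ^ n * s) ≤ (G s₀)⁻¹ * r ^ n * G s := by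
  have hK : 1 ≤ (G s₀)⁻¹ := (one_le_inv₀ (hGpos _ hs₀)).2 (hG1 _)
  have hK0 : 0 ≤ (G s₀)⁻¹ := zero_le_one.trans hK
  induction n with
  | zero => intro s hs _; simpa using le_mul_of_one_le_left (hGpos s hs).le hK
  | succ n ih =>
    intro s hs hss
    have hd := hdouble s hs hss
    have hr0 : 0 ≤ r := zero_le_one.trans hr
    rcases le_total (2 * s) s₀ with h | h
    · calc G (2 ^ (n + 1) * s) = G (2 ^ n * (2 * s)) := by ring_nf
        _ ≤ (G s₀)⁻¹ * r ^ n * G (2 * s) := ih _ (by linarith) h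
        _ ≤ (G s₀)⁻¹ * r ^ n * (r * G s) := by gcongr
        _ = _ := by ring
    · calc G (2 ^ (n + 1) * s) ≤ 1 := hG1 _
        _ = (G s₀)⁻¹ * G s₀ := (inv_mul_cancel₀ (hGpos _ hs₀).ne').symm
        _ ≤ (G s₀)⁻¹ * (r * G s) := by gcongr; exact (hG h).trans hd
        _ ≤ (G s₀)⁻¹ * (r ^ (n + 1) * G s) := by
            have := hGpos s hs
            gcongr
            exact le_self_pow₀ hr (by omega)
        _ = _ := by ring

lemma tendsto_exp_neg_of_bounds {h : ℝ → ℝ} {R : ℝ → ℝ → ℝ}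
    (hR : ∀ x, Tendsto (R x) atTop (nhds (Real.exp (-x)))) {y₀ : ℝ}
    (lo : ∀ y > y₀, ∀ᶠ t in atTop, R y t ≤ h t) (hi : ∀ y < y₀, ∀ᶠ t in atTop, h t ≤ R y t) :
    Tendsto h atTop (nhds (Real.exp (-y₀))) := by
  have hc : ContinuousAt (fun y : ℝ => Real.exp (-y)) y₀ := by fun_prop
  refine tendsto_order.2 ⟨fun b hb => ?_, fun b hb => ?_⟩
  · obtain ⟨y, hy, hyb⟩ := ((eventually_mem_nhdsWithin
      (a := y₀) (s := Set.Ioi y₀)).and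
      ((hc.eventually (lt_mem_nhds hb)).filter_mono nhdsWithin_le_nhds :
        ∀ᶠ y in nhdsWithin y₀ (Set.Ioi y₀), b < Real.exp (-y))).exists
    filter_upwards [lo y hy, (hR y).eventually (lt_mem_nhds hyb)] with t h1 h2
    exact h2.trans_le h1
  · obtain ⟨y, hy, hyb⟩ := ((eventually_mem_nhdsWithin
      (a := y₀) (s := Set.Iio y₀)).and
      ((hc.eventually (gt_mem_nhds hb)).filter_mono nhdsWithin_le_nhds :
        ∀ᶠ y in nhdsWithin y₀ (Set.Iio y₀), Real.exp (-y) < b)).exists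
    filter_upwards [hi y hy, (hR y).eventually (gt_mem_nhds hyb)] with t h1 h2
    exact h1.trans_lt h2

/-- A function bounded by `1` and by `r⁻²ⁿ` beyond `K * rⁿ` has a uniform Cauchy-type envelope. -/
lemma le_inv_one_add_sq_of_geometric_decay {f : ℝ → ℝ} {K r : ℝ} (hK : 1 ≤ K) (hr : 1 < r)
    (h1 : ∀ v, 0 < v → f v ≤ 1)
    (hf : ∀ n : ℕ, ∀ v, K * r ^ n ≤ v → f v ≤ ((r ^ 2)⁻¹) ^ n) {v : ℝ} (hv : 0 < v) :
    f v ≤ 2 * (K * r) ^ 2 * (1 + v ^ 2)⁻¹ := by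
  have hB : 1 ≤ K * r := by nlinarith
  rw [← div_eq_mul_inv, le_div_iff₀ (by positivity)]
  have hB2 : 1 ≤ (K * r) ^ 2 := one_le_pow₀ hB
  rcases lt_or_ge v K with hvK | hvK
  · have : v ^ 2 ≤ (K * r) ^ 2 := by
      gcongr
      nlinarith
    nlinarith [h1 v hv]
  · obtain ⟨n, hn1, hn2⟩ := exists_nat_pow_near (show 1 ≤ v / K by rwa [one_le_div (by linarith)]) hr
    rw [le_div_iff₀ (by linarith)] at hn1
    rw [div_lt_iff₀ (by linarith)] at hn2
    have h3 := hf n v (by linarith)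
    have h4 : v ^ 2 ≤ (r ^ (n + 1) * K) ^ 2 := by gcongr
    have h5 : ((r ^ 2)⁻¹) ^ n * (r ^ n) ^ 2 = 1 := by
      rw [← pow_mul, mul_comm n 2, pow_mul, ← mul_pow, inv_mul_cancel₀ (by positivity), one_pow]
    have h6 : 0 ≤ ((r ^ 2)⁻¹) ^ n := by positivity
    have h7 : f v * (1 + v ^ 2) ≤ ((r ^ 2)⁻¹) ^ n * (1 + v ^ 2) := by gcongr
    have h8 : ((r ^ 2)⁻¹) ^ n * v ^ 2 ≤ (K * r) ^ 2 := by
      calc _ ≤ ((r ^ 2)⁻¹) ^ n * (r ^ (n + 1) * K) ^ 2 := by gcongr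
        _ = (((r ^ 2)⁻¹) ^ n * (r ^ n) ^ 2) * (K * r) ^ 2 := by ring
        _ = _ := by rw [h5, one_mul]
    have h9 : ((r ^ 2)⁻¹) ^ n ≤ 1 := pow_le_one₀ (by positivity)
      (inv_le_one_of_one_le₀ (one_le_pow₀ hr.le))
    nlinarith

lemma measurable_measure_mul_gt {Ω : Type*} [MeasurableSpace Ω]
    {μ : Measure Ω} [IsProbabilityMeasure μ] {C : Ω → ℝ} (hC : Measurable C) (u : ℝ) :
    Measurable fun x => μ {ω | C ω * x > u} :=
  measurable_measure_prodMk_right (μ := μ) (s := {p : Ω × ℝ | C p.1 * p.2 > u})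
    (measurableSet_lt measurable_const ((hC.comp measurable_fst).mul measurable_snd))

lemma measure_mul_gt_toReal_eq_integral {Ω : Type*} [MeasurableSpace Ω]
    {μ : Measure Ω} [IsProbabilityMeasure μ] {C X : Ω → ℝ} (hC : Measurable C)
    (hX : Measurable X) (hind : IndepFun C X μ) (u : ℝ) :
    (μ {ω | C ω * X ω > u}).toReal = ∫ ω, (μ {ω' | C ω' * X ω > u}).toReal ∂μ := by
  have := Measure.isProbabilityMeasure_map (μ := μ) hC.aemeasurable
  have := Measure.isProbabilityMeasure_map (μ := μ) hX.aemeasurable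
  have hS : MeasurableSet {p : ℝ × ℝ | p.1 * p.2 > u} :=
    measurableSet_lt measurable_const (measurable_fst.mul measurable_snd)
  have h1 : μ {ω | C ω * X ω > u} = (μ.map fun ω => (C ω, X ω)) {p : ℝ × ℝ | p.1 * p.2 > u} := by
    rw [Measure.map_apply (hC.prodMk hX) hS]; rfl
  have h2 : ∀ x : ℝ, (μ.map C) ((fun c => (c, x)) ⁻¹' {p : ℝ × ℝ | p.1 * p.2 > u})
      = μ {ω' | C ω' * x > u} := fun x => by
    rw [Measure.map_apply hC (measurable_prodMk_right hS)]; rfl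
  have hm := measurable_measure_mul_gt (μ := μ) hC u
  rw [h1, (indepFun_iff_map_prod_eq_prod_map_map hC.aemeasurable hX.aemeasurable).1 hind,
    Measure.prod_apply_symm hS]
  simp only [h2]
  rw [lintegral_map hm hX]
  exact (integral_toReal (hm.comp hX).aemeasurable
    (ae_of_all _ fun ω => measure_lt_top _ _)).symm

/-- Lemma (Model B): if `X₁` is in the Gumbel MDA with auxiliary function `a` and
`C₁` is an independent scaling with upper endpoint `w` satisfying Model B (regular
variation of index `γ` at `w`), then
`P(C₁X₁ > tw) ~ Γ(γ+1)·P(C₁ > w − w·a(t)/t)·P(X₁ > t)` as `t → ∞`. -/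
theorem product_tail_gumbel_modelB
    {Ω : Type*} [MeasureSpace Ω] [IsProbabilityMeasure (ℙ : Measure Ω)]
    (C₁ X₁ : Ω → ℝ) (hCmeas : Measurable C₁) (hXmeas : Measurable X₁)
    (hCpos : ∀ ω, 0 < C₁ ω) (hXpos : ∀ ω, 0 < X₁ ω)
    (hindep : IndepFun C₁ X₁ ℙ)
    -- `X₁` has df in the Gumbel MDA with infinite right endpoint and auxiliary function `a`
    (a : ℝ → ℝ) (ha_meas : Measurable a) (ha_pos : ∀ t, 0 < a t)
    (ha_small : Tendsto (fun t => a t / t) atTop (nhds 0))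
    (hinf : ∀ t : ℝ, 0 < (ℙ {ω | X₁ ω > t}).toReal)
    (hGumbel : ∀ x : ℝ, Tendsto (fun t : ℝ =>
        (ℙ {ω | X₁ ω > t + a t * x}).toReal / (ℙ {ω | X₁ ω > t}).toReal)
        atTop (nhds (Real.exp (-x))))
    -- `C₁` has upper endpoint `w ∈ (0,∞)`
    (w : ℝ) (hw : 0 < w)
    (hCw : (ℙ {ω | C₁ ω ≤ w}).toReal = 1)
    (hCw' : ∀ ε : ℝ, 0 < ε → 0 < (ℙ {ω | C₁ ω > w - ε}).toReal)
    -- Model B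
    (γ : ℝ) (hγ : 0 ≤ γ)
    (hMB : ∀ x : ℝ, 0 < x → Tendsto (fun t : ℝ =>
        (ℙ {ω | C₁ ω > w - x / t}).toReal / (ℙ {ω | C₁ ω > w - 1 / t}).toReal)
        atTop (nhds (x ^ γ))) :
    Tendsto (fun t : ℝ =>
        (ℙ {ω | C₁ ω * X₁ ω > t * w}).toReal /
          (Real.Gamma (γ + 1) * (ℙ {ω | C₁ ω > w - w * a t / t}).toReal *
            (ℙ {ω | X₁ ω > t}).toReal)) atTop (nhds 1) := by
  have hFanti : Antitone fun t : ℝ => (ℙ {ω | X₁ ω > t}).toReal := fun t u htu =>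
    ENNReal.toReal_mono (measure_ne_top _ _) (measure_mono fun ω hω => lt_of_le_of_lt htu hω)
  obtain ⟨G, hG⟩ : ∃ G : ℝ → ℝ, G = fun s => (ℙ {ω | C₁ ω > w - s}).toReal := ⟨_, rfl⟩
  obtain ⟨F, hF⟩ : ∃ F : ℝ → ℝ, F = fun t => (ℙ {ω | X₁ ω > t}).toReal := ⟨_, rfl⟩
  obtain ⟨s, hs⟩ : ∃ s : ℝ → ℝ, s = fun t => w * a t / t := ⟨_, rfl⟩
  have hGdef : ∀ s, (ℙ {ω | C₁ ω > w - s}).toReal = G s := fun s => by rw [hG]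
  have hFdef : ∀ t, (ℙ {ω | X₁ ω > t}).toReal = F t := fun s => by rw [hF]
  have hsdef : ∀ t, w * a t / t = s t := fun s => by rw [hs]
  simp only [hGdef, hFdef, hsdef] at hinf hGumbel hCw' hMB hFanti ⊢
  have hGmono : Monotone G := fun x y hxy => by
    rw [← hGdef, ← hGdef]
    refine ENNReal.toReal_mono (measure_ne_top _ _) (measure_mono fun ω hω => ?_)
    simp only [Set.mem_ofPred_eq, gt_iff_lt] at *
    linarith
  have hG0 : G 0 = 0 := by
    have hle : ℙ {ω | C₁ ω ≤ w} = 1 := by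
      rw [← ENNReal.toReal_eq_one_iff]; exact hCw
    have := (prob_compl_eq_zero_iff (measurableSet_le hCmeas measurable_const)).2 hle
    rw [← hGdef, ENNReal.toReal_eq_zero_iff]
    left
    refine measure_mono_null (fun ω hω => ?_) this
    simpa using hω
  have hG1 : ∀ x, G x ≤ 1 := fun x => by
    rw [← hGdef]; exact ENNReal.toReal_le_of_le_ofReal zero_le_one (by simpa using prob_le_one)
  have hspos : ∀ t, 0 < t → 0 < s t := fun t ht => by
    rw [← hsdef]; exact div_pos (mul_pos hw (ha_pos t)) ht
  have hGspos : ∀ t, 0 < t → 0 < G (s t) := fun t ht => hCw' _ (hspos t ht)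
  have hs0 : Tendsto s atTop (nhds 0) := by
    have := ha_small.const_mul w
    rw [mul_zero] at this
    exact this.congr fun t => by rw [← hsdef]; ring
  have hsinv : Tendsto (fun t => (s t)⁻¹) atTop atTop :=
    tendsto_inv_nhdsGT_zero.comp (tendsto_nhdsWithin_iff.2
      ⟨hs0, (eventually_gt_atTop 0).mono fun t ht => hspos t ht⟩)
  have hGs : ∀ x, 0 < x → Tendsto (fun t => G (x * s t) / G (s t)) atTop (nhds (x ^ γ)) :=
    fun x hx => ((hMB x hx).comp hsinv).congr fun t => by simp
  -- the upper envelope of the conditional probability given `X₁`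
  have hup : ∀ t, 0 < t → ∀ y, 0 ≤ y → ∀ ω, X₁ ω ≤ t + a t * y →
      (ℙ {ω' | C₁ ω' * X₁ ω > t * w}).toReal ≤ G (y * s t) := by
    intro t ht y hy ω hω
    rw [← hGdef]
    refine ENNReal.toReal_mono (measure_ne_top _ _) (measure_mono fun ω' hω' => ?_)
    simp only [Set.mem_ofPred_eq, gt_iff_lt] at *
    have h0 : 0 ≤ a t * y := mul_nonneg (ha_pos t).le hy
    have h1 : t * w < C₁ ω' * (t + a t * y) :=
      hω'.trans_le (mul_le_mul_of_nonneg_left hω (hCpos _).le)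
    have h2 : (w - y * s t) * (t + a t * y) ≤ t * w := by
      have : s t * t = w * a t := by rw [← hsdef]; field_simp
      have h3 : 0 ≤ y * s t * (a t * y) := by have := hspos t ht; positivity
      nlinarith
    exact lt_of_mul_lt_mul_right (h2.trans_lt h1) (by linarith)
  have hlow : ∀ z y, 0 < z → z < y → ∀ᶠ t in atTop, ∀ ω, t + a t * y < X₁ ω →
      G (z * s t) ≤ (ℙ {ω' | C₁ ω' * X₁ ω > t * w}).toReal := by
    intro z y hz hzy
    have hlim : Tendsto (fun t => z * y * (a t / t)) atTop (nhds 0) := by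
      simpa using ha_small.const_mul (z * y)
    filter_upwards [hlim.eventually (gt_mem_nhds (sub_pos.2 hzy)), eventually_gt_atTop 0]
      with t h1 ht ω hω
    rw [← hGdef]
    refine ENNReal.toReal_mono (measure_ne_top _ _) (measure_mono fun ω' hω' => ?_)
    simp only [Set.mem_ofPred_eq, gt_iff_lt] at *
    have hy : 0 < y := hz.trans hzy
    have hat := ha_pos t
    have h2 : t * w ≤ (w - z * s t) * (t + a t * y) := by
      have e : (w - z * s t) * (t + a t * y) - t * w
          = w * a t * ((y - z) - z * y * (a t / t)) := by
        rw [← hsdef]; field_simp; ring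
      have : 0 ≤ w * a t * ((y - z) - z * y * (a t / t)) :=
        mul_nonneg (by positivity) (by linarith)
      linarith
    have h3 : 0 < t + a t * y := by positivity
    calc t * w ≤ _ := h2
      _ < C₁ ω' * (t + a t * y) := mul_lt_mul_of_pos_right hω' h3
      _ ≤ _ := mul_le_mul_of_nonneg_left hω.le (hCpos _).le
  obtain ⟨f, hf⟩ : ∃ f : ℝ → Ω → ℝ, f = fun t ω =>
    (ℙ {ω' | C₁ ω' * X₁ ω > t * w}).toReal / G (s t) := ⟨_, rfl⟩
  have hf_le : ∀ t, 0 < t → ∀ y, 0 ≤ y → ∀ v, G (y * s t) / G (s t) ≤ v →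
      (ℙ : Measure Ω).real {ω | v < f t ω} / F t ≤ F (t + a t * y) / F t := by
    intro t ht y hy v hv
    refine div_le_div_of_nonneg_right ?_ (hinf t).le
    rw [← hFdef]
    refine measureReal_mono (fun ω hω => ?_)
    by_contra hc
    have := (div_le_div_of_nonneg_right (hup t ht y hy ω (not_lt.1 hc)) (hGspos t ht).le).trans hv
    simp only [hf, Set.mem_ofPred_eq] at hω
    exact absurd hω (not_lt.2 this)
  have hf_ge : ∀ y, 0 < y → ∀ v, v < y ^ γ → ∀ᶠ t in atTop,
      F (t + a t * y) / F t ≤ (ℙ : Measure Ω).real {ω | v < f t ω} / F t := by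
    intro y hy v hv
    have hc : ContinuousAt (fun y : ℝ => y ^ γ) y :=
      Real.continuousAt_rpow_const _ _ (Or.inl hy.ne')
    obtain ⟨z, hzy, hz, hzv⟩ := ((eventually_mem_nhdsWithin
      (a := y) (s := Set.Iio y)).and
      (((lt_mem_nhds hy).and (hc.eventually (lt_mem_nhds hv))).filter_mono
        nhdsWithin_le_nhds)).exists
    filter_upwards [hlow z y hz hzy, (hGs z hz).eventually (lt_mem_nhds hzv),
      eventually_gt_atTop 0] with t h1 h2 ht
    refine div_le_div_of_nonneg_right ?_ (hinf t).le
    rw [← hFdef]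
    refine measureReal_mono (fun ω hω => ?_)
    simp only [hf, Set.mem_ofPred_eq]
    exact h2.trans_le (div_le_div_of_nonneg_right (h1 ω hω) (hGspos t ht).le)
  have hf_le' : ∀ y, 0 < y → ∀ v, y ^ γ < v → ∀ᶠ t in atTop,
      (ℙ : Measure Ω).real {ω | v < f t ω} / F t ≤ F (t + a t * y) / F t := by
    intro y hy v hv
    filter_upwards [(hGs y hy).eventually (gt_mem_nhds hv), eventually_gt_atTop 0] with t h1 ht
    exact hf_le t ht y hy.le v h1.le
  have hf_one : ∀ t, 0 < t → ∀ v, 0 < v → (ℙ : Measure Ω).real {ω | v < f t ω} / F t ≤ 1 := by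
    intro t ht v hv
    have := hf_le t ht 0 le_rfl v (by simpa [hG0] using hv.le)
    rwa [mul_zero, add_zero, div_self (hinf t).ne'] at this
  have hf_one' : ∀ y ≤ 0, ∀ v, 0 < v → ∀ᶠ t in atTop,
      (ℙ : Measure Ω).real {ω | v < f t ω} / F t ≤ F (t + a t * y) / F t := by
    intro y hy v hv
    filter_upwards [eventually_gt_atTop 0] with t ht
    refine (hf_one t ht v hv).trans ((one_le_div (hinf t)).2 (hFanti ?_))
    nlinarith [ha_pos t]
  obtain ⟨L, hLlim, hLint⟩ : ∃ L : ℝ → ℝ, (∀ v, 0 < v → v ≠ 1 →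
      Tendsto (fun t => (ℙ : Measure Ω).real {ω | v < f t ω} / F t) atTop (nhds (L v))) ∧
      ∫ v in Set.Ioi 0, L v = Real.Gamma (γ + 1) := by
    rcases hγ.eq_or_lt with rfl | hγ
    · refine ⟨(Set.Iio 1).indicator 1, fun v hv hv1 => ?_, ?_⟩
      · rcases lt_or_gt_of_ne hv1 with h | h
        · have := tendsto_exp_neg_of_bounds hGumbel (y₀ := 0)
            (fun y hy => hf_ge y hy v (by simpa using h)) (fun y hy => hf_one' y hy.le v hv)
          simpa [Set.indicator_of_mem (Set.mem_Iio.2 h)] using this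
        · rw [Set.indicator_of_notMem (by simpa using h.le)]
          refine tendsto_order.2 ⟨fun b hb => ?_, fun b hb => ?_⟩
          · filter_upwards [] with t
            exact hb.trans_le (div_nonneg measureReal_nonneg (hinf t).le)
          · obtain ⟨y, hyb, hy⟩ := ((Real.tendsto_exp_neg_atTop_nhds_zero.eventually
              (gt_mem_nhds hb)).and (eventually_gt_atTop 0)).exists
            filter_upwards [hf_le' y hy v (by simpa using h),
              (hGumbel y).eventually (gt_mem_nhds hyb)] with t h1 h2
            exact h1.trans_lt h2
      · rw [setIntegral_indicator measurableSet_Iio]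
        simp [Set.Ioi_inter_Iio]
    · refine ⟨fun v => Real.exp (-v ^ (1 / γ)), fun v hv _ => ?_, ?_⟩
      · have hvy : (v ^ (1 / γ)) ^ γ = v := by
          rw [← Real.rpow_mul hv.le, one_div_mul_cancel hγ.ne', Real.rpow_one]
        have h0 : 0 < v ^ (1 / γ) := Real.rpow_pos_of_pos hv _
        refine tendsto_exp_neg_of_bounds hGumbel (fun y hy => ?_) (fun y hy => ?_)
        · refine hf_ge y (h0.trans hy) v ?_
          have := Real.rpow_lt_rpow h0.le hy hγ
          rwa [hvy] at this
        · rcases le_or_gt y 0 with hy0 | hy0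
          · exact hf_one' y hy0 v hv
          · refine hf_le' y hy0 v ?_
            have := Real.rpow_lt_rpow hy0.le hy hγ
            rwa [hvy] at this
      · have := integral_exp_neg_rpow (p := 1 / γ) (by positivity)
        simpa using this
  -- an integrable envelope
  obtain ⟨B, hB⟩ : ∃ B : ℝ, ∀ᶠ t in atTop, ∀ v, 0 < v →
      (ℙ : Measure Ω).real {ω | v < f t ω} / F t ≤ B * (1 + v ^ 2)⁻¹ := by
    have hr : (1 : ℝ) < 2 ^ (γ + 1) := Real.one_lt_rpow one_lt_two (by linarith)
    obtain ⟨T, hT⟩ := eventually_atTop.1 ((hMB 2 two_pos).eventually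
      (gt_mem_nhds (Real.rpow_lt_rpow_of_exponent_lt one_lt_two (lt_add_one γ))))
    set r : ℝ := 2 ^ (γ + 1) with hrdef
    have hT0 : 0 < max T 1 := lt_max_of_lt_right one_pos
    have hdouble : ∀ x, 0 < x → x ≤ (max T 1)⁻¹ → G (2 * x) ≤ r * G x := by
      intro x hx hxT
      have := hT x⁻¹ ((le_max_left T 1).trans ((le_inv_comm₀ hx hT0).1 hxT))
      simp only [div_inv_eq_mul, one_mul] at this
      exact ((div_lt_iff₀ (hCw' x hx)).1 this).le
    have hpotter := apply_two_pow_mul_le hGmono hG1 hCw' hr.le (inv_pos.2 hT0) hdouble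
    have hK : 1 ≤ (G (max T 1)⁻¹)⁻¹ := (one_le_inv₀ (hCw' _ (inv_pos.2 hT0))).2 (hG1 _)
    set K := (G (max T 1)⁻¹)⁻¹
    obtain ⟨k, hk⟩ := exists_eventually_tail_le hFanti hinf ha_pos hGumbel
      (r := (r ^ 2)⁻¹) (by positivity)
    refine ⟨2 * (K * r ^ k * r) ^ 2, ?_⟩
    filter_upwards [hk, eventually_gt_atTop 0, hs0.eventually (gt_mem_nhds (inv_pos.2 hT0))]
      with t hkt ht hst v hv
    refine le_inv_one_add_sq_of_geometric_decay
      (f := fun v => (ℙ : Measure Ω).real {ω | v < f t ω} / F t)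
      (by nlinarith [one_le_pow₀ hr.le (n := k)]) hr (hf_one t ht) (fun n v hv => ?_) hv
    refine (hf_le t ht (2 ^ (n + k)) (by positivity) v ?_).trans
      ((div_le_iff₀ (hinf t)).2 (hkt n))
    rw [div_le_iff₀ (hGspos t ht)]
    refine (hpotter (n + k) _ (hspos t ht) hst.le).trans
      (mul_le_mul_of_nonneg_right (le_trans (le_of_eq ?_) hv) (hGspos t ht).le)
    rw [pow_add]; ring
  have hmain : Tendsto (fun t => ∫ v in Set.Ioi 0, (ℙ : Measure Ω).real {ω | v < f t ω} / F t)
      atTop (nhds (∫ v in Set.Ioi 0, L v)) := by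
    refine tendsto_integral_filter_of_dominated_convergence (fun v => B * (1 + v ^ 2)⁻¹)
      (Eventually.of_forall fun t => ?_) ?_
      (integrable_inv_one_add_sq.const_mul B).integrableOn ?_
    · refine Measurable.aestronglyMeasurable (Antitone.measurable fun u v huv => ?_)
      exact div_le_div_of_nonneg_right
        (measureReal_mono fun ω hω => lt_of_le_of_lt huv hω) (hinf t).le
    · filter_upwards [hB] with t ht
      refine (ae_restrict_iff' measurableSet_Ioi).2 (ae_of_all _ fun v hv => ?_)
      rw [Real.norm_of_nonneg (div_nonneg measureReal_nonneg (hinf t).le)]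
      exact ht v hv
    · refine (ae_restrict_iff' measurableSet_Ioi).2 ?_
      filter_upwards [Measure.ae_ne volume (1 : ℝ)] with v hv1 hv
      exact hLlim v hv hv1
  rw [hLint] at hmain
  have hΓ : 0 < Real.Gamma (γ + 1) := Real.Gamma_pos_of_pos (by linarith)
  have hlast := hmain.div_const (Real.Gamma (γ + 1))
  rw [div_self hΓ.ne'] at hlast
  refine hlast.congr' ?_
  filter_upwards [eventually_gt_atTop 0] with t ht
  have hmeas : Measurable fun ω => (ℙ {ω' | C₁ ω' * X₁ ω > t * w}).toReal :=
    ((measurable_measure_mul_gt hCmeas (t * w)).comp hXmeas).ennreal_toReal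
  have hint : Integrable (f t) ℙ := by
    rw [hf]
    refine Integrable.div_const (Integrable.of_bound hmeas.aestronglyMeasurable 1
      (ae_of_all _ fun ω => ?_)) _
    rw [Real.norm_of_nonneg ENNReal.toReal_nonneg]
    exact measureReal_le_one
  have hlayer := hint.integral_eq_integral_meas_lt (ae_of_all _ fun ω => by
    rw [hf]; exact div_nonneg ENNReal.toReal_nonneg (hGspos t ht).le)
  rw [integral_div, ← hlayer, measure_mul_gt_toReal_eq_integral hCmeas hXmeas hindep, hf,
    integral_div]
  field_simp
end

section
/- Let C, X, Y be three positive random variables such that C is independent of the pair (X,Y) and X is regularly varying with index -α for some α≥0. If E[C^β]<∞ for some β>α and lim_{t→∞} P(Y>t)/P(X>t)=0, then lim_{t→∞} P(CY>t)/P(X>t)=0. -/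
open MeasureTheory ProbabilityTheory Filter Real

theorem antitone_real_tail {Ω : Type*} [MeasurableSpace Ω] (μ : Measure Ω)
    [IsFiniteMeasure μ] (X : Ω → ℝ) : Antitone (fun t : ℝ => (μ {ω | X ω > t}).toReal) := by
  intro s t hst
  refine ENNReal.toReal_mono (measure_ne_top _ _) (measure_mono fun ω hω => ?_)
  exact lt_of_le_of_lt hst hω

/-- Potter-type bound: control of an antitone function under halving of its argument
gives control under division by any `c ≥ 1`. -/
theorem Antitone.le_rpow_mul_of_halving {F : ℝ → ℝ} (hF : Antitone F) (hF0 : ∀ t, 0 ≤ F t)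
    {T γ : ℝ} (hT : 0 < T) (hγ : 0 ≤ γ) (h : ∀ t, T ≤ t → F (t / 2) ≤ 2 ^ γ * F t)
    {c t : ℝ} (hc : 1 ≤ c) (hct : T * c ≤ t) : F (t / c) ≤ 2 ^ γ * c ^ γ * F t := by
  have iter : ∀ n : ℕ, ∀ t, T * 2 ^ n ≤ t → F (t / 2 ^ (n + 1)) ≤ (2 ^ γ) ^ (n + 1) * F t := by
    intro n
    induction n with
    | zero => intro t ht; simpa using h t (by simpa using ht)
    | succ k ih =>
      intro t ht
      have hk : (1 : ℝ) ≤ 2 ^ (k + 1) := one_le_pow₀ (by norm_num)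
      have ht2 : T * 2 ^ k ≤ t / 2 := by rw [pow_succ] at ht; linarith
      have h1 := ih (t / 2) ht2
      have h2 := h t (le_trans (by nlinarith) ht)
      calc F (t / 2 ^ (k + 1 + 1)) = F (t / 2 / 2 ^ (k + 1)) := by
            congr 1; rw [div_div, pow_succ' 2 (k + 1)]
        _ ≤ (2 ^ γ) ^ (k + 1) * F (t / 2) := h1
        _ ≤ (2 ^ γ) ^ (k + 1) * (2 ^ γ * F t) := by gcongr
        _ = _ := by ring
  obtain ⟨n, hn, hn'⟩ := exists_nat_pow_near hc (one_lt_two : (1 : ℝ) < 2)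
  have hc0 : 0 < c := by linarith
  have ht : 0 ≤ t := le_trans (by positivity) hct
  calc F (t / c) ≤ F (t / 2 ^ (n + 1)) := hF (by gcongr)
    _ ≤ (2 ^ γ) ^ (n + 1) * F t := iter n t (le_trans (by gcongr) hct)
    _ = 2 ^ γ * ((2 : ℝ) ^ n) ^ γ * F t := by
        rw [pow_succ', ← Real.rpow_natCast, ← Real.rpow_mul (by norm_num), mul_comm γ,
          Real.rpow_mul (by norm_num), Real.rpow_natCast]
    _ ≤ 2 ^ γ * c ^ γ * F t := by
        have := hF0 t
        gcongr

/-- Conditioning on an independent positive factor bounds the tail of a product. -/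
theorem ProbabilityTheory.IndepFun.real_tail_mul_le_integral {Ω : Type*} [MeasurableSpace Ω]
    {μ : Measure Ω} [IsProbabilityMeasure μ] {C Y : Ω → ℝ} (hC : Measurable C)
    (hY : Measurable Y) (hCpos : ∀ ω, 0 < C ω) (hind : IndepFun C Y μ) {t : ℝ} {b : ℝ → ℝ}
    (hb : ∀ c, 0 < c → (μ {ω | Y ω > t / c}).toReal ≤ b c)
    (hbint : Integrable (fun ω => b (C ω)) μ) :
    (μ {ω | C ω * Y ω > t}).toReal ≤ ∫ ω, b (C ω) ∂μ := by
  have hb0 : ∀ ω, 0 ≤ b (C ω) := fun ω => ENNReal.toReal_nonneg.trans (hb _ (hCpos ω))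
  refine ENNReal.toReal_le_of_le_ofReal (integral_nonneg hb0) ?_
  have hS : MeasurableSet {p : ℝ × ℝ | p.1 * p.2 > t} :=
    measurableSet_lt measurable_const (measurable_fst.mul measurable_snd)
  have hpre : {ω | C ω * Y ω > t} = (fun ω => (C ω, Y ω)) ⁻¹' {p : ℝ × ℝ | p.1 * p.2 > t} := rfl
  rw [hpre, ← Measure.map_apply (hC.prodMk hY) hS,
    (indepFun_iff_map_prod_eq_prod_map_map hC.aemeasurable hY.aemeasurable).1 hind,
    Measure.prod_apply hS, lintegral_map (measurable_measure_prodMk_left hS) hC,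
    ofReal_integral_eq_lintegral_ofReal hbint (ae_of_all _ hb0)]
  refine lintegral_mono fun ω => ?_
  rw [Measure.map_apply hY (measurable_prodMk_left hS)]
  have heq : Y ⁻¹' (Prod.mk (C ω) ⁻¹' {p : ℝ × ℝ | p.1 * p.2 > t}) = {η | Y η > t / C ω} := by
    ext η
    simp only [Set.mem_preimage, Set.mem_ofPred_eq, gt_iff_lt, div_lt_iff₀' (hCpos ω)]
  rw [heq]
  exact (ENNReal.le_ofReal_iff_toReal_le (measure_ne_top _ _) (hb0 ω)).2 (hb _ (hCpos ω))

/-- Pointwise bound on a rescaled tail `G (t / c)`, in terms of a tail `F` dominating `G`. -/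
theorem rescaled_tail_le {F G : ℝ → ℝ} (hF : Antitone F) (hF0 : ∀ t, 0 ≤ F t)
    (hG : Antitone G) (hG1 : ∀ t, G t ≤ 1) {T γ β δ : ℝ} (hT : 0 < T) (hγ : 0 ≤ γ)
    (hγβ : γ ≤ β) (hδ : 0 ≤ δ) (hhalf : ∀ t, T ≤ t → F (t / 2) ≤ 2 ^ γ * F t)
    (hGF : ∀ t, T ≤ t → G t ≤ δ * F t) {c t : ℝ} (hc : 0 < c) (ht : T ≤ t) :
    G (t / c) ≤ δ * 2 ^ γ * F t * (1 + c ^ β) + (T / t) ^ β * c ^ β := by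
  have ht0 : 0 < t := hT.trans_le ht
  have hFt := hF0 t
  have hK : (1 : ℝ) ≤ 2 ^ γ := Real.one_le_rpow (by norm_num) hγ
  have hcβ : 0 ≤ c ^ β := by positivity
  rcases le_total c 1 with hc1 | hc1
  · calc G (t / c) ≤ G t := hG ((le_div_iff₀ hc).2 (by nlinarith))
      _ ≤ δ * 1 * F t * (1 + 0) + 0 := by simpa using hGF t ht
      _ ≤ _ := by gcongr; positivity
  rcases le_total (T * c) t with hct | hct
  · calc G (t / c) ≤ δ * F (t / c) := hGF _ ((le_div_iff₀ hc).2 hct)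
      _ ≤ δ * (2 ^ γ * c ^ γ * F t) := by
        gcongr; exact hF.le_rpow_mul_of_halving hF0 hT hγ hhalf hc1 hct
      _ ≤ δ * (2 ^ γ * c ^ β * F t) := by gcongr
      _ = δ * 2 ^ γ * F t * (0 + c ^ β) + 0 := by ring
      _ ≤ _ := by
        gcongr
        · exact zero_le_one
        · positivity
  · have h1 : 1 ≤ (T / t) ^ β * c ^ β := by
      rw [← Real.mul_rpow (by positivity) hc.le]
      refine Real.one_le_rpow ?_ (hγ.trans hγβ)
      rw [div_mul_eq_mul_div, le_div_iff₀ ht0]; linarith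
    have h2 : 0 ≤ δ * 2 ^ γ * F t * (1 + c ^ β) := by positivity
    linarith [hG1 (t / c)]

/-- Lemma: if `C` is independent of `(X,Y)`, `X` is regularly varying with index `-α`,
`E[C^β] < ∞` for some `β > α`, and `P(Y > t) = o(P(X > t))`, then
`P(CY > t) = o(P(X > t))`. -/
theorem scaled_negligible_tail_via_moment
    {Ω : Type*} [MeasureSpace Ω] [IsProbabilityMeasure (ℙ : Measure Ω)]
    (C X Y : Ω → ℝ) (hCmeas : Measurable C) (hXmeas : Measurable X) (hYmeas : Measurable Y)
    (hCpos : ∀ ω, 0 < C ω) (hXpos : ∀ ω, 0 < X ω) (hYpos : ∀ ω, 0 < Y ω)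
    (hindep : IndepFun C (fun ω => (X ω, Y ω)) ℙ)
    (α : ℝ) (hα : 0 ≤ α)
    (hreg : ∀ x : ℝ, 0 < x →
      Tendsto (fun t : ℝ =>
        (ℙ {ω | X ω > t * x}).toReal / (ℙ {ω | X ω > t}).toReal) atTop (nhds (x ^ (-α))))
    (β : ℝ) (hβ : α < β)
    (hmom : Integrable (fun ω => C ω ^ β) ℙ)
    (hY : Tendsto (fun t : ℝ =>
        (ℙ {ω | Y ω > t}).toReal / (ℙ {ω | X ω > t}).toReal) atTop (nhds 0)) :
    Tendsto (fun t : ℝ =>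
        (ℙ {ω | C ω * Y ω > t}).toReal / (ℙ {ω | X ω > t}).toReal) atTop (nhds 0) := by
  set F : ℝ → ℝ := fun t => (ℙ {ω | X ω > t}).toReal
  set G : ℝ → ℝ := fun t => (ℙ {ω | Y ω > t}).toReal
  have hFanti : Antitone F := antitone_real_tail ℙ X
  have hGanti : Antitone G := antitone_real_tail ℙ Y
  have hF0 : ∀ t, 0 ≤ F t := fun t => ENNReal.toReal_nonneg
  have hFpos : ∀ t, 0 < F t := by
    have h1 := hreg 1 one_pos
    simp only [mul_one, Real.one_rpow] at h1
    intro t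
    obtain ⟨s, hs, hts⟩ :=
      ((h1.eventually (lt_mem_nhds one_half_lt_one)).and (eventually_ge_atTop t)).exists
    refine lt_of_lt_of_le ((hF0 s).lt_of_ne fun h0 => ?_) (hFanti hts)
    change 1 / 2 < F s / F s at hs
    rw [← h0] at hs
    norm_num at hs
  obtain ⟨γ, hαγ, hγβ⟩ := exists_between hβ
  have hγ : 0 ≤ γ := hα.trans hαγ.le
  have hhalf : ∀ᶠ t in atTop, F (t / 2) ≤ 2 ^ γ * F t := by
    have hlt : ((2 : ℝ)⁻¹) ^ (-α) < 2 ^ γ := by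
      rw [Real.inv_rpow (by norm_num), Real.rpow_neg (by norm_num), inv_inv]
      exact Real.rpow_lt_rpow_of_exponent_lt (by norm_num) hαγ
    filter_upwards [(hreg 2⁻¹ (by norm_num)).eventually (gt_mem_nhds hlt)] with t ht
    exact ((div_lt_iff₀ (hFpos t)).1 ht).le
  set M : ℝ := ∫ ω, C ω ^ β with hM
  have hM0 : 0 ≤ M := integral_nonneg fun ω => Real.rpow_nonneg (hCpos ω).le _
  have hK : (0 : ℝ) < 2 ^ γ := by positivity
  have hindY : IndepFun C Y ℙ := hindep.comp measurable_id measurable_snd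
  rw [Metric.tendsto_nhds]
  intro ε hε
  set δ : ℝ := ε / (2 * (2 ^ γ * (1 + M))) with hδdef
  have hδ : 0 < δ := by positivity
  have hGF : ∀ᶠ t in atTop, G t ≤ δ * F t := by
    filter_upwards [hY.eventually (gt_mem_nhds hδ)] with t ht
    exact ((div_lt_iff₀ (hFpos t)).1 ht).le
  obtain ⟨T, hT⟩ := eventually_atTop.1 ((hhalf.and hGF).and (eventually_gt_atTop 0))
  have hT0 : 0 < T := (hT T le_rfl).2
  have hlim : Tendsto (fun t : ℝ => M * (2 ^ γ / F T) * (t / T) ^ (-(β - γ))) atTop (nhds 0) := by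
    have h := ((tendsto_rpow_neg_atTop (sub_pos.2 hγβ)).comp
      (tendsto_id.atTop_div_const hT0)).const_mul (M * (2 ^ γ / F T))
    simpa using h
  filter_upwards [hlim.eventually (gt_mem_nhds (half_pos hε)), eventually_ge_atTop T]
    with t hsmall htT
  have ht0 : 0 < t := hT0.trans_le htT
  have hadd : Integrable (fun ω => 1 + C ω ^ β) ℙ := (integrable_const 1).add hmom
  have hmain := hindY.real_tail_mul_le_integral hCmeas hYmeas hCpos (t := t)
    (b := fun c => δ * 2 ^ γ * F t * (1 + c ^ β) + (T / t) ^ β * c ^ β)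
    (fun c hc => rescaled_tail_le hFanti hF0 hGanti (fun s => measureReal_le_one) hT0 hγ hγβ.le
      hδ.le (fun s hs => (hT s hs).1.1) (fun s hs => (hT s hs).1.2) hc htT)
    ((hadd.const_mul _).add (hmom.const_mul _))
  have hint : ∫ ω, (δ * 2 ^ γ * F t * (1 + C ω ^ β) + (T / t) ^ β * C ω ^ β)
      = δ * 2 ^ γ * F t * (1 + M) + (T / t) ^ β * M := by
    rw [integral_add (hadd.const_mul _) (hmom.const_mul _),
      integral_const_mul, integral_const_mul, integral_add (integrable_const 1) hmom]
    simp [hM]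
  rw [hint] at hmain
  have hfirst : δ * 2 ^ γ * F t * (1 + M) = ε / 2 * F t := by
    rw [hδdef]; field_simp
  have hlow : F T ≤ 2 ^ γ * (t / T) ^ γ * F t := by
    have h := hFanti.le_rpow_mul_of_halving hF0 hT0 hγ (fun s hs => (hT s hs).1.1)
      (c := t / T) (t := t) ((one_le_div hT0).2 htT) (by rw [mul_div_cancel₀ _ hT0.ne'])
    rwa [div_div_cancel₀ ht0.ne'] at h
  have hsecond : (T / t) ^ β * M ≤ M * (2 ^ γ / F T) * (t / T) ^ (-(β - γ)) * F t := by
    have hr : 0 < t / T := by positivity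
    have e1 : (T / t) ^ β = (t / T) ^ (-β) := by
      rw [Real.rpow_neg hr.le, ← Real.inv_rpow hr.le, inv_div]
    have e2 : (t / T) ^ (-(β - γ)) = (t / T) ^ (-β) * (t / T) ^ γ := by
      rw [← Real.rpow_add hr]; congr 1; ring
    rw [e1, e2]
    calc (t / T) ^ (-β) * M = M * (t / T) ^ (-β) * 1 := by ring
      _ ≤ M * (t / T) ^ (-β) * (2 ^ γ * (t / T) ^ γ * F t / F T) := by
        gcongr; exact (one_le_div (hFpos T)).2 hlow
      _ = _ := by ring
  rw [Real.dist_0_eq_abs, abs_of_nonneg (div_nonneg ENNReal.toReal_nonneg (hF0 t)),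
    div_lt_iff₀ (hFpos t)]
  have := mul_lt_mul_of_pos_right hsmall (hFpos t)
  linarith
end

section
/- Let X_1,...,X_n be positive random variables with X_1 in the Gumbel max-domain of attraction with infinite right endpoint and auxiliary function a(·) satisfying lim_{t→∞} a(t+a(t)x)/a(t)=1 locally uniformly in x. Let C_1>0 and C* ≥ C_1 be random variables such that the distribution of C_1X_1 is in the Gumbel max-domain of attraction with the same auxiliary function a(·), and suppose that for every x>0, lim_{t→∞} max_{1≤i≠j≤n} P(C*X_i>t, C*X_j>a(t)x)/P(C_1X_1>t)=0. Then for every real x_1 and every x_2>0, max_{1≤i≠j≤n} P(C*X_i > t+a(t)x_1, C*X_j > a(t)x_2) = o(P(C_1X_1 > t)) as t→∞. -/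
open MeasureTheory ProbabilityTheory Filter Real

/-- Technical step in the proof of Lemma 4.4: the joint-tail negligibility condition
self-improves to shifted thresholds `t + a(t)x₁` and `a(t)x₂`. -/
theorem joint_tail_negligible_shifted
    {Ω : Type*} [MeasureSpace Ω] [IsProbabilityMeasure (ℙ : Measure Ω)]
    (n : ℕ) (X : Fin (n + 1) → Ω → ℝ) (hXmeas : ∀ i, Measurable (X i))
    (hXpos : ∀ i ω, 0 < X i ω)
    -- `X 0` has df in the Gumbel MDA with infinite right endpoint and auxiliary function `a`
    (a : ℝ → ℝ) (ha_meas : Measurable a) (ha_pos : ∀ t, 0 < a t)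
    (ha_small : Tendsto (fun t => a t / t) atTop (nhds 0))
    (hinf : ∀ t : ℝ, 0 < (ℙ {ω | X 0 ω > t}).toReal)
    (hGumbel : ∀ x : ℝ, Tendsto (fun t : ℝ =>
        (ℙ {ω | X 0 ω > t + a t * x}).toReal / (ℙ {ω | X 0 ω > t}).toReal)
        atTop (nhds (Real.exp (-x))))
    -- the auxiliary function is self-neglecting, locally uniformly in `x`
    (ha_lu : TendstoLocallyUniformly (fun t x => a (t + a t * x) / a t) (fun _ => 1) atTop)
    (C₁ Cs : Ω → ℝ) (hC₁meas : Measurable C₁) (hCsmeas : Measurable Cs)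
    (hC₁pos : ∀ ω, 0 < C₁ ω) (hC₁Cs : ∀ ω, C₁ ω ≤ Cs ω)
    -- the law of `C₁X₁` is in the Gumbel MDA with the same auxiliary function `a`
    (hCXinf : ∀ t : ℝ, 0 < (ℙ {ω | C₁ ω * X 0 ω > t}).toReal)
    (hCXGumbel : ∀ x : ℝ, Tendsto (fun t : ℝ =>
        (ℙ {ω | C₁ ω * X 0 ω > t + a t * x}).toReal /
          (ℙ {ω | C₁ ω * X 0 ω > t}).toReal) atTop (nhds (Real.exp (-x))))
    (hcond1 : ∀ x : ℝ, 0 < x → ∀ i j : Fin (n + 1), i ≠ j →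
      Tendsto (fun t : ℝ =>
        (ℙ {ω | Cs ω * X i ω > t ∧ Cs ω * X j ω > a t * x}).toReal /
          (ℙ {ω | C₁ ω * X 0 ω > t}).toReal) atTop (nhds 0)) :
    ∀ x₁ x₂ : ℝ, 0 < x₂ → ∀ i j : Fin (n + 1), i ≠ j →
      Tendsto (fun t : ℝ =>
        (ℙ {ω | Cs ω * X i ω > t + a t * x₁ ∧ Cs ω * X j ω > a t * x₂}).toReal /
          (ℙ {ω | C₁ ω * X 0 ω > t}).toReal) atTop (nhds 0) := by
  intro x₁ x₂ hx₂ i j hij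
  have hs : Tendsto (fun t => t + a t * x₁) atTop atTop := by
    have hfactor : Tendsto (fun t => 1 + a t / t * x₁) atTop (nhds 1) := by
      simpa using (ha_small.mul_const x₁).const_add 1
    refine (tendsto_id.atTop_mul_pos one_pos hfactor).congr' ?_
    filter_upwards [eventually_gt_atTop 0] with t ht
    simp only [id]
    field_simp
  have ha : Tendsto (fun t => a (t + a t * x₁) / a t) atTop (nhds 1) :=
    (tendstoLocallyUniformlyOn_univ.mpr ha_lu).tendsto_at (Set.mem_univ x₁)
  have hlim := ((hcond1 (x₂ / 2) (half_pos hx₂) i j hij).comp hs).mul (hCXGumbel x₁)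
  rw [zero_mul] at hlim
  refine squeeze_zero' (.of_forall fun t => by positivity) ?_ hlim
  filter_upwards [ha.eventually_le_const one_lt_two] with t ht
  have hthreshold : a (t + a t * x₁) * (x₂ / 2) ≤ a t * x₂ := by
    rw [div_le_iff₀ (ha_pos t)] at ht
    nlinarith
  simp only [Function.comp_apply]
  rw [div_mul_div_cancel₀ (hCXinf _).ne']
  gcongr
  · exact measure_ne_top _ _
end

section
/- Let X_1,...,X_n be positive random variables with X_1 in the Gumbel max-domain of attraction with infinite right endpoint and auxiliary function a(·). Let C_1, C* be random variables with 0 < C_1 ≤ C* and suppose that for every x>0, lim_{t→∞} max_{1≤i≠j≤n} P(C*X_i>t, C*X_j>a(t)x)/P(C_1X_1>t)=0. Then for all 1≤i<j≤n, P(C_1X_i>t, C_1X_j>t) = o(P(C_1X_1>t)) as t→∞. -/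
open MeasureTheory ProbabilityTheory Filter Real

/-- Equation (last eq): under the Gumbel-MDA assumption on `X₁` and the joint-tail
negligibility condition for `C*`, the joint tails of `(C₁X_i, C₁X_j)` are
negligible with respect to `P(C₁X₁ > t)`. -/
theorem joint_tail_negligible_scaled
    {Ω : Type*} [MeasureSpace Ω] [IsProbabilityMeasure (ℙ : Measure Ω)]
    (n : ℕ) (X : Fin (n + 1) → Ω → ℝ) (hXmeas : ∀ i, Measurable (X i))
    (hXpos : ∀ i ω, 0 < X i ω)
    -- `X 0` has df in the Gumbel MDA with infinite right endpoint and auxiliary function `a`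
    (a : ℝ → ℝ) (ha_meas : Measurable a) (ha_pos : ∀ t, 0 < a t)
    (ha_small : Tendsto (fun t => a t / t) atTop (nhds 0))
    (hinf : ∀ t : ℝ, 0 < (ℙ {ω | X 0 ω > t}).toReal)
    (hGumbel : ∀ x : ℝ, Tendsto (fun t : ℝ =>
        (ℙ {ω | X 0 ω > t + a t * x}).toReal / (ℙ {ω | X 0 ω > t}).toReal)
        atTop (nhds (Real.exp (-x))))
    (C₁ Cs : Ω → ℝ) (hC₁meas : Measurable C₁) (hCsmeas : Measurable Cs)
    (hC₁pos : ∀ ω, 0 < C₁ ω) (hC₁Cs : ∀ ω, C₁ ω ≤ Cs ω)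
    (hcond1 : ∀ x : ℝ, 0 < x → ∀ i j : Fin (n + 1), i ≠ j →
      Tendsto (fun t : ℝ =>
        (ℙ {ω | Cs ω * X i ω > t ∧ Cs ω * X j ω > a t * x}).toReal /
          (ℙ {ω | C₁ ω * X 0 ω > t}).toReal) atTop (nhds 0)) :
    ∀ i j : Fin (n + 1), i < j →
      Tendsto (fun t : ℝ =>
        (ℙ {ω | C₁ ω * X i ω > t ∧ C₁ ω * X j ω > t}).toReal /
          (ℙ {ω | C₁ ω * X 0 ω > t}).toReal) atTop (nhds 0) := by
  intro i j hij
  refine squeeze_zero' (Eventually.of_forall fun t => by positivity) ?_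
    (hcond1 1 one_pos i j hij.ne)
  filter_upwards [ha_small.eventually (gt_mem_nhds one_pos), eventually_gt_atTop 0] with t hat ht
  rw [div_lt_one ht] at hat
  refine div_le_div_of_nonneg_right (ENNReal.toReal_mono (measure_ne_top _ _)
    (measure_mono ?_)) ENNReal.toReal_nonneg
  have hle : ∀ k ω, C₁ ω * X k ω ≤ Cs ω * X k ω := fun k ω =>
    mul_le_mul_of_nonneg_right (hC₁Cs ω) (hXpos k ω).le
  rintro ω ⟨hi, hj⟩
  exact ⟨hi.trans_le (hle i ω), by simpa using hat.trans (hj.trans_le (hle j ω))⟩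
end

section
/- Let (Z_1,Z_2) be a bivariate Gaussian random vector with standard normal marginals and correlation coefficient ρ ∈ (−1,1). Then lim_{u→∞} log P(Z_1>u, Z_2>u) / u² = −1/(2η²), where η = max_{0≤θ≤2π} min( sin θ, ρ sin θ + √(1−ρ²) cos θ ) = √((1+ρ)/2) < 1; equivalently, lim_{u→∞} log P(Z_1>u, Z_2>u)/u² = −1/(1+ρ). -/
open MeasureTheory ProbabilityTheory Filter Real

lemma hasSubgaussianMGF_of_map_eq_gaussianReal {Ω : Type*} [MeasurableSpace Ω] {μ : Measure Ω}
    {X : Ω → ℝ} (hX : Measurable X) (h : μ.map X = gaussianReal 0 1) :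
    HasSubgaussianMGF X 1 μ where
  integrable_exp_mul t := by
    have hint := integrable_exp_mul_gaussianReal (μ := 0) (v := 1) t
    rw [← h] at hint
    exact hint.comp_measurable hX
  mgf_le t := by simp [mgf_gaussianReal h t]

lemma exp_le_gaussianReal_Ioc {x : ℝ} (hx : 0 ≤ x) :
    (√(2 * π))⁻¹ * rexp (-(x + 1) ^ 2 / 2) ≤ (gaussianReal 0 1).real (Set.Ioc x (x + 1)) := by
  rw [measureReal_def, gaussianReal_apply_eq_integral _ one_ne_zero,
    ENNReal.toReal_ofReal (integral_nonneg fun y => gaussianPDFReal_nonneg 0 1 y)]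
  have h := setIntegral_ge_of_const_le_real (μ := volume) (f := gaussianPDFReal 0 1)
    (c := (√(2 * π))⁻¹ * rexp (-(x + 1) ^ 2 / 2)) (measurableSet_Ioc (a := x) (b := x + 1))
    (by simp) ?_ (integrable_gaussianPDFReal 0 1).integrableOn
  · simpa using h
  · intro y hy
    simp only [gaussianPDFReal, NNReal.coe_one, mul_one, sub_zero]
    gcongr
    · linarith [hy.1]
    · exact hy.2

lemma isGreatest_min_sin_correlation {ρ : ℝ} (hρ1 : -1 < ρ) (hρ2 : ρ < 1) :
    IsGreatest ((fun θ => min (sin θ) (ρ * sin θ + √(1 - ρ ^ 2) * cos θ)) '' Set.Icc 0 (2 * π))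
      √((1 + ρ) / 2) := by
  have hs : √(1 - ρ ^ 2) ^ 2 = 1 - ρ ^ 2 := sq_sqrt (by nlinarith)
  have hη : √((1 + ρ) / 2) ^ 2 = (1 + ρ) / 2 := sq_sqrt (by linarith)
  have hη0 : 0 ≤ √((1 + ρ) / 2) := sqrt_nonneg _
  constructor
  · have hsin : sin (arcsin √((1 + ρ) / 2)) = √((1 + ρ) / 2) :=
      sin_arcsin (by linarith) (sqrt_le_one.2 (by linarith))
    have hcos : √(1 - ρ ^ 2) * cos (arcsin √((1 + ρ) / 2)) = (1 - ρ) * √((1 + ρ) / 2) := by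
      rw [cos_arcsin, hη, ← sqrt_mul (by nlinarith),
        sqrt_eq_iff_mul_self_eq (by nlinarith) (by nlinarith)]
      linear_combination -(1 - ρ) ^ 2 * hη
    refine ⟨arcsin √((1 + ρ) / 2),
      ⟨arcsin_nonneg.2 hη0, by linarith [arcsin_le_pi_div_two √((1 + ρ) / 2), pi_pos]⟩, ?_⟩
    simp only [hsin, hcos]
    rw [show ρ * √((1 + ρ) / 2) + (1 - ρ) * √((1 + ρ) / 2) = √((1 + ρ) / 2) by ring, min_self]
  · rintro _ ⟨θ, -, rfl⟩
    set s := √(1 - ρ ^ 2)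
    have havg : ((1 + ρ) * sin θ + s * cos θ) / 2 ≤ √((1 + ρ) / 2) := by
      apply le_sqrt_of_sq_le
      have := sq_nonneg ((1 + ρ) * cos θ - s * sin θ)
      have hid : ((1 + ρ) * sin θ + s * cos θ) ^ 2 + ((1 + ρ) * cos θ - s * sin θ) ^ 2
          = 2 * (1 + ρ) := by
        linear_combination ((1 + ρ) ^ 2 + s ^ 2) * sin_sq_add_cos_sq θ + hs
      nlinarith
    have h1 := min_le_left (sin θ) (ρ * sin θ + s * cos θ)
    have h2 := min_le_right (sin θ) (ρ * sin θ + s * cos θ)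
    dsimp only
    linarith

section JointTail

variable {Ω : Type*} [MeasurableSpace Ω] {μ : Measure Ω} {ρ : ℝ} {X W : Ω → ℝ}

/-- Chernoff bound for the joint tail, through the tail of the sum of the two coordinates. -/
lemma joint_tail_le [IsFiniteMeasure μ] (hρ1 : -1 < ρ) (hρ2 : ρ < 1) (hX : Measurable X)
    (hW : Measurable W) (hXmap : μ.map X = gaussianReal 0 1) (hWmap : μ.map W = gaussianReal 0 1)
    (hindep : IndepFun X W μ) {u : ℝ} (hu : 0 ≤ u) :
    μ.real {ω | X ω > u ∧ ρ * X ω + √(1 - ρ ^ 2) * W ω > u} ≤ rexp (-u ^ 2 / (1 + ρ)) := by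
  have hs : √(1 - ρ ^ 2) ^ 2 = 1 - ρ ^ 2 := sq_sqrt (by nlinarith)
  have hsum := ((hasSubgaussianMGF_of_map_eq_gaussianReal hX hXmap).const_mul
    (1 + ρ)).add_of_indepFun ((hasSubgaussianMGF_of_map_eq_gaussianReal hW hWmap).const_mul √(1 - ρ ^ 2))
    (hindep.comp (measurable_const_mul (1 + ρ)) (measurable_const_mul √(1 - ρ ^ 2)))
  have htail : μ.real {ω | 2 * u ≤ (1 + ρ) * X ω + √(1 - ρ ^ 2) * W ω} ≤
      rexp (-(2 * u) ^ 2 / (2 * ((1 + ρ) ^ 2 * 1 + √(1 - ρ ^ 2) ^ 2 * 1))) :=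
    hsum.measure_ge_le (by positivity)
  have hexp : -(2 * u) ^ 2 / (2 * ((1 + ρ) ^ 2 + √(1 - ρ ^ 2) ^ 2)) = -u ^ 2 / (1 + ρ) := by
    have : 1 + ρ ≠ 0 := by linarith
    rw [hs, show (1 + ρ) ^ 2 + (1 - ρ ^ 2) = 2 * (1 + ρ) by ring]
    field_simp
  rw [mul_one, mul_one, hexp] at htail
  refine (measureReal_mono ?_).trans htail
  rintro ω ⟨h1, h2⟩
  rw [Set.mem_ofPred_eq]
  linarith

/-- The joint tail contains a product of unit intervals placed near the dominating point
`(u, (1 - ρ) / √(1 - ρ ^ 2) * u)`. -/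
lemma le_joint_tail [IsFiniteMeasure μ] (hρ1 : -1 < ρ) (hρ2 : ρ < 1) (hX : Measurable X)
    (hW : Measurable W) (hXmap : μ.map X = gaussianReal 0 1) (hWmap : μ.map W = gaussianReal 0 1)
    (hindep : IndepFun X W μ) {u : ℝ} (hu : 0 ≤ u) :
    (2 * π)⁻¹ * rexp (-(u + 1) ^ 2 / 2
        - ((1 - ρ) / √(1 - ρ ^ 2) * u + |ρ| / √(1 - ρ ^ 2) + 1) ^ 2 / 2) ≤
      μ.real {ω | X ω > u ∧ ρ * X ω + √(1 - ρ ^ 2) * W ω > u} := by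
  have hs : 0 < √(1 - ρ ^ 2) := sqrt_pos.2 (by nlinarith)
  set s := √(1 - ρ ^ 2)
  set v := (1 - ρ) / s * u + |ρ| / s with hv
  have hsv : s * v = (1 - ρ) * u + |ρ| := by rw [hv]; field_simp
  have hv0 : 0 ≤ v := by
    have : 0 ≤ 1 - ρ := by linarith
    positivity
  have hprod : μ.real (X ⁻¹' Set.Ioc u (u + 1) ∩ W ⁻¹' Set.Ioc v (v + 1)) =
      (gaussianReal 0 1).real (Set.Ioc u (u + 1)) * (gaussianReal 0 1).real (Set.Ioc v (v + 1)) := by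
    rw [measureReal_def,
      hindep.measure_inter_preimage_eq_mul _ _ measurableSet_Ioc measurableSet_Ioc,
      ENNReal.toReal_mul, ← Measure.map_apply hX measurableSet_Ioc,
      ← Measure.map_apply hW measurableSet_Ioc, hXmap, hWmap, measureReal_def, measureReal_def]
  have hsub : X ⁻¹' Set.Ioc u (u + 1) ∩ W ⁻¹' Set.Ioc v (v + 1) ⊆
      {ω | X ω > u ∧ ρ * X ω + s * W ω > u} := by
    rintro ω ⟨⟨hX1, hX2⟩, hW1, -⟩
    refine ⟨hX1, ?_⟩
    have h1 : s * v < s * W ω := by gcongr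
    have h2 : -|ρ| ≤ ρ * (X ω - u) := by
      have := neg_abs_le ρ
      nlinarith [abs_nonneg ρ]
    linarith
  calc (2 * π)⁻¹ * rexp (-(u + 1) ^ 2 / 2 - (v + 1) ^ 2 / 2)
      = ((√(2 * π))⁻¹ * rexp (-(u + 1) ^ 2 / 2)) * ((√(2 * π))⁻¹ * rexp (-(v + 1) ^ 2 / 2)) := by
        rw [mul_mul_mul_comm, ← exp_add, ← mul_inv, mul_self_sqrt (by positivity)]
        ring_nf
    _ ≤ _ := mul_le_mul (exp_le_gaussianReal_Ioc hu) (exp_le_gaussianReal_Ioc hv0)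
        (by positivity) measureReal_nonneg
    _ ≤ _ := hprod ▸ measureReal_mono hsub

lemma tendsto_log_joint_tail [IsFiniteMeasure μ] (hρ1 : -1 < ρ) (hρ2 : ρ < 1) (hX : Measurable X)
    (hW : Measurable W) (hXmap : μ.map X = gaussianReal 0 1) (hWmap : μ.map W = gaussianReal 0 1)
    (hindep : IndepFun X W μ) :
    Tendsto (fun u : ℝ =>
        log (μ.real {ω | X ω > u ∧ ρ * X ω + √(1 - ρ ^ 2) * W ω > u}) / u ^ 2)
      atTop (nhds (-(1 / (1 + ρ)))) := by
  have hs : √(1 - ρ ^ 2) ^ 2 = 1 - ρ ^ 2 := sq_sqrt (by nlinarith)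
  set a := (1 - ρ) / √(1 - ρ ^ 2) with ha
  set c := |ρ| / √(1 - ρ ^ 2)
  have hlower : Tendsto (fun u : ℝ => -log (2 * π) * u⁻¹ ^ 2 - (1 + u⁻¹) ^ 2 / 2
      - (a + (c + 1) * u⁻¹) ^ 2 / 2) atTop (nhds (-(1 / (1 + ρ)))) := by
    have hcont : Continuous fun x : ℝ => -log (2 * π) * x ^ 2 - (1 + x) ^ 2 / 2
      - (a + (c + 1) * x) ^ 2 / 2 := by fun_prop
    have hlim := (hcont.tendsto 0).comp tendsto_inv_atTop_zero
    have hval : -log (2 * π) * (0 : ℝ) ^ 2 - (1 + 0) ^ 2 / 2 - (a + (c + 1) * 0) ^ 2 / 2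
        = -(1 / (1 + ρ)) := by
      have h1 : 1 + ρ ≠ 0 := by linarith
      have h2 : 1 - ρ ≠ 0 := by linarith
      have ha2 : a ^ 2 = (1 - ρ) / (1 + ρ) := by
        rw [ha, div_pow, hs, show 1 - ρ ^ 2 = (1 - ρ) * (1 + ρ) by ring]
        field_simp
      rw [mul_zero, add_zero, add_zero, ha2]
      field_simp
      ring
    rwa [hval] at hlim
  refine tendsto_of_tendsto_of_tendsto_of_le_of_le' hlower tendsto_const_nhds ?_ ?_
  · filter_upwards [eventually_gt_atTop 0] with u hu
    have h := log_le_log (by positivity)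
      (le_joint_tail hρ1 hρ2 hX hW hXmap hWmap hindep hu.le)
    rw [log_mul (by positivity) (exp_ne_zero _), log_exp, log_inv] at h
    rw [le_div_iff₀ (by positivity)]
    refine le_of_eq_of_le ?_ h
    field_simp
    ring
  · filter_upwards [eventually_gt_atTop 0] with u hu
    have hpos := (by positivity : (0 : ℝ) < _).trans_le
      (le_joint_tail hρ1 hρ2 hX hW hXmap hWmap hindep hu.le)
    have h := log_le_log hpos (joint_tail_le hρ1 hρ2 hX hW hXmap hWmap hindep hu.le)
    rw [log_exp] at h
    rw [div_le_iff₀ (by positivity)]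
    exact h.trans_eq (by ring)

end JointTail

/-- Logarithmic joint-tail asymptotics for a bivariate Gaussian vector with standard
normal marginals and correlation `ρ ∈ (-1,1)`: the constant
`η = max_θ min(sin θ, ρ sin θ + √(1-ρ²) cos θ)` equals `√((1+ρ)/2) < 1` and
`log P(Z₁>u, Z₂>u)/u² → −1/(2η²) = −1/(1+ρ)`. -/
theorem bivariate_gaussian_joint_tail_log_asymptotics
    {Ω : Type*} [MeasureSpace Ω] [IsProbabilityMeasure (ℙ : Measure Ω)]
    (ρ : ℝ) (hρ1 : -1 < ρ) (hρ2 : ρ < 1)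
    (Z₁ W Z₂ : Ω → ℝ) (hZ₁meas : Measurable Z₁) (hWmeas : Measurable W)
    (hZ₁ : Measure.map Z₁ (ℙ : Measure Ω) = gaussianReal 0 1)
    (hW : Measure.map W (ℙ : Measure Ω) = gaussianReal 0 1)
    (hindep : IndepFun Z₁ W ℙ)
    (hZ₂ : ∀ ω, Z₂ ω = ρ * Z₁ ω + Real.sqrt (1 - ρ ^ 2) * W ω) :
    IsGreatest
      ((fun θ => min (Real.sin θ) (ρ * Real.sin θ + Real.sqrt (1 - ρ ^ 2) * Real.cos θ)) ''
        Set.Icc 0 (2 * Real.pi))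
      (Real.sqrt ((1 + ρ) / 2)) ∧
    Real.sqrt ((1 + ρ) / 2) < 1 ∧
    -(1 / (2 * Real.sqrt ((1 + ρ) / 2) ^ 2)) = -(1 / (1 + ρ)) ∧
    Tendsto (fun u : ℝ =>
        Real.log (ℙ {ω | Z₁ ω > u ∧ Z₂ ω > u}).toReal / u ^ 2)
      atTop (nhds (-(1 / (1 + ρ)))) := by
  refine ⟨isGreatest_min_sin_correlation hρ1 hρ2, ?_, ?_, ?_⟩
  · rw [sqrt_lt' one_pos]
    linarith
  · rw [sq_sqrt (by linarith), mul_div_cancel₀ _ two_ne_zero]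
  · simp only [hZ₂]
    exact tendsto_log_joint_tail hρ1 hρ2 hZ₁meas hWmeas hZ₁ hW hindep
end

section
/- Let X_1 = exp(σZ + μ) be a Log-Normal random variable, where Z is standard normal, σ>0, μ ∈ ℝ, and let C_1 be a Beta-distributed random variable on [0,1] with positive parameters a and b, independent of X_1. Then, with a(t) = σ²t/(log t − μ), as t→∞, P(C_1X_1 > t) ~ Γ(b+1) · P(C_1 > 1 − a(t)/t) · P(X_1 > t). -/
open MeasureTheory ProbabilityTheory Filter Real

/-- The upper tail of a Beta-type density with normalizing constant `B` at the endpoint `1` is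
asymptotic to `y ^ b / (b * B)`. -/
lemma tendsto_beta_tail_div_rpow {a b B : ℝ} (ha : 0 < a) (hb : 0 < b) (hB : 0 < B) :
    Tendsto (fun y : ℝ => ((volume : Measure ℝ).withDensity (fun x =>
        ENNReal.ofReal (if x ∈ Set.Ioo (0 : ℝ) 1 then
          x ^ (a - 1) * (1 - x) ^ (b - 1) / B else 0))).real (Set.Ioi (1 - y)) / y ^ b)
      (nhdsWithin 0 (Set.Ioi 0)) (nhds (1 / (b * B))) := by
  set f : ℝ → ℝ := fun x => if x ∈ Set.Ioo (0 : ℝ) 1 then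
          x ^ (a - 1) * (1 - x) ^ (b - 1) / B else 0 with hf
  have hfm : Measurable f := Measurable.ite measurableSet_Ioo (by fun_prop) (by fun_prop)
  have hf0 : ∀ x, 0 ≤ f x := by
    intro x
    simp only [hf]
    split_ifs with h
    · have h1 : 0 < x := h.1
      have h2 : 0 < 1 - x := by linarith [h.2]
      positivity
    · exact le_rfl
  have hrescale : ∀ y : ℝ, 0 < y → y < 1 / 2 →
      ((volume : Measure ℝ).withDensity (fun x => ENNReal.ofReal (f x))).real (Set.Ioi (1 - y))
        / y ^ b
      = ∫ u in Set.Ioo (0 : ℝ) 1, (1 - y * u) ^ (a - 1) * u ^ (b - 1) / B := by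
    intro y hy hy2
    have e1 : ((volume : Measure ℝ).withDensity (fun x => ENNReal.ofReal (f x))).real
        (Set.Ioi (1 - y)) = ∫ x, (Set.Ioi (1 - y)).indicator f x := by
      rw [integral_indicator measurableSet_Ioi, measureReal_def,
        withDensity_apply _ measurableSet_Ioi,
        integral_eq_lintegral_of_nonneg_ae (Eventually.of_forall hf0) hfm.aestronglyMeasurable]
    have e2 : ∫ x, (Set.Ioi (1 - y)).indicator f x
        = y * ∫ u, (Set.Ioi (1 - y)).indicator f (1 - y * u) := by
      rw [← integral_sub_left_eq_self (fun x => (Set.Ioi (1 - y)).indicator f x) volume 1,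
        Measure.integral_comp_mul_left (fun x => (Set.Ioi (1 - y)).indicator f (1 - x)) y,
        abs_of_pos (inv_pos.2 hy), smul_eq_mul, mul_inv_cancel_left₀ hy.ne']
    rw [e1, e2, ← integral_const_mul, ← integral_div, ← integral_indicator measurableSet_Ioo]
    congr 1
    ext u
    by_cases hu : u ∈ Set.Ioo (0 : ℝ) 1
    · have h1 : y * u < y := by nlinarith [hu.2]
      have h2 : 0 < y * u := mul_pos hy hu.1
      rw [Set.indicator_of_mem hu, Set.indicator_of_mem (show 1 - y * u ∈ Set.Ioi (1 - y) by
        simp only [Set.mem_Ioi]; linarith)]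
      simp only [hf]
      rw [if_pos ⟨by linarith, by linarith⟩, sub_sub_cancel, mul_rpow hy.le hu.1.le,
        rpow_sub_one hy.ne']
      have := rpow_pos_of_pos hy b
      field_simp
    · rw [Set.indicator_of_notMem hu]
      simp only [Set.indicator, hf, Set.mem_Ioi, Set.mem_Ioo]
      split_ifs with h1 h2
      · exfalso
        apply hu
        have h3 : 0 < y * u := by linarith [h2.2]
        exact ⟨pos_of_mul_pos_right h3 hy.le, by nlinarith⟩
      · simp
      · simp
  have hlim : ∫ u in Set.Ioo (0 : ℝ) 1, u ^ (b - 1) / B = 1 / (b * B) := by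
    rw [integral_div, ← integral_Ioc_eq_integral_Ioo,
      ← intervalIntegral.integral_of_le zero_le_one, integral_rpow (Or.inl (by linarith))]
    simp [hb.ne']
    field_simp
  have hint : IntegrableOn (fun u : ℝ => u ^ (b - 1)) (Set.Ioo 0 1) := by
    have := intervalIntegral.intervalIntegrable_rpow' (a := 0) (b := 1) (r := b - 1)
      (by linarith)
    rw [intervalIntegrable_iff_integrableOn_Ioc_of_le zero_le_one] at this
    exact this.mono_set Set.Ioo_subset_Ioc_self
  have hsmall : ∀ᶠ y : ℝ in nhdsWithin 0 (Set.Ioi 0), 0 < y ∧ y < 1 / 2 :=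
    Ioo_mem_nhdsGT (by norm_num)
  rw [← hlim]
  refine Tendsto.congr' (f₁ := fun y : ℝ =>
    ∫ u in Set.Ioo (0 : ℝ) 1, (1 - y * u) ^ (a - 1) * u ^ (b - 1) / B) ?_ ?_
  · filter_upwards [hsmall] with y hy using (hrescale y hy.1 hy.2).symm
  · refine tendsto_integral_filter_of_dominated_convergence (fun u => 2 * u ^ (b - 1) / B) ?_ ?_
      ((hint.const_mul 2).div_const B) ?_
    · exact Eventually.of_forall fun y =>
        (by fun_prop : Measurable fun u : ℝ =>
          (1 - y * u) ^ (a - 1) * u ^ (b - 1) / B).aestronglyMeasurable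
    · filter_upwards [hsmall] with y hy
      refine ae_restrict_of_forall_mem measurableSet_Ioo fun u hu => ?_
      have h1 : 0 < u := hu.1
      have h2 : y * u < 1 / 2 := by nlinarith [hu.2, hy.1, hy.2]
      have h3 : 0 < y * u := mul_pos hy.1 h1
      have h4 : (1 - y * u) ^ (a - 1) ≤ 2 := by
        calc (1 - y * u) ^ (a - 1) ≤ (1 - y * u) ^ (-1 : ℝ) :=
              rpow_le_rpow_of_exponent_ge (by linarith) (by linarith) (by linarith)
          _ = (1 - y * u)⁻¹ := rpow_neg_one _
          _ ≤ 2 := by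
              rw [inv_le_comm₀ (by linarith) two_pos]
              linarith
      have h5 : 0 ≤ (1 - y * u) ^ (a - 1) := rpow_nonneg (by linarith) _
      rw [norm_of_nonneg (by positivity)]
      gcongr
    · refine ae_restrict_of_forall_mem measurableSet_Ioo fun u hu => ?_
      have hbase : Tendsto (fun y : ℝ => 1 - y * u) (nhdsWithin 0 (Set.Ioi 0)) (nhds 1) := by
        have : Tendsto (fun y : ℝ => 1 - y * u) (nhds 0) (nhds (1 - 0 * u)) :=
          (by fun_prop : Continuous fun y : ℝ => 1 - y * u).tendsto 0
        simpa using this.mono_left nhdsWithin_le_nhds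
      have h := (hbase.rpow_const (p := a - 1) (Or.inl one_ne_zero)).mul_const (u ^ (b - 1) / B)
      simpa [mul_div_assoc] using h

/-- A nonnegative function bounded by `1` that is asymptotic to `κ * r ^ b` at `0+` is bounded by
a multiple of `r ^ b` on the positive half-line. -/
lemma exists_le_mul_rpow_of_tendsto {G : ℝ → ℝ} {b κ : ℝ} (hb : 0 ≤ b) (hG1 : ∀ r, G r ≤ 1)
    (hG : Tendsto (fun r => G r / r ^ b) (nhdsWithin 0 (Set.Ioi 0)) (nhds κ)) :
    ∃ K : ℝ, ∀ r, 0 < r → G r ≤ K * r ^ b := by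
  have h := hG.eventually (eventually_le_nhds (lt_add_one κ))
  obtain ⟨δ, hδ, hsub⟩ := mem_nhdsGT_iff_exists_Ioo_subset.1 h
  have hδ : 0 < δ := hδ
  refine ⟨max (κ + 1) (1 / δ ^ b), fun r hr => ?_⟩
  have hrb : 0 < r ^ b := rpow_pos_of_pos hr b
  have hδb : 0 < δ ^ b := rpow_pos_of_pos hδ b
  rw [← div_le_iff₀ hrb]
  rcases lt_or_ge r δ with hlt | hge
  · exact le_max_of_le_left (hsub ⟨hr, hlt⟩)
  · refine le_max_of_le_right ?_
    have := rpow_le_rpow hδ.le hge hb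
    have h1 := hG1 r
    gcongr

/-- Rescaling the standard Gaussian integral around a high level `z`. -/
lemma integral_gaussianReal_rescale (g : ℝ → ℝ) {z : ℝ} (hz : 0 < z) :
    ∫ x, g (x - z) ∂gaussianReal 0 1
      = gaussianPDFReal 0 1 z / z * ∫ s, exp (-s) * exp (-s ^ 2 / (2 * z ^ 2)) * g (s / z) := by
  rw [integral_gaussianReal_eq_integral_smul one_ne_zero,
    ← integral_add_left_eq_self _ z, div_mul_eq_mul_div, ← integral_const_mul]
  have := Measure.integral_comp_div
    (fun x => gaussianPDFReal 0 1 (z + x) • g (z + x - z)) z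
  rw [abs_of_pos hz, smul_eq_mul] at this
  rw [eq_div_iff hz.ne', mul_comm, ← this]
  congr 1
  ext s
  simp only [gaussianPDFReal_def, add_sub_cancel_left, smul_eq_mul, ← mul_assoc]
  congr 1
  simp only [mul_assoc, ← exp_add]
  congr 2
  simp only [NNReal.coe_one]
  field_simp
  ring

/-- A Laplace-type limit for functions regularly varying at `0+`. -/
lemma tendsto_integral_exp_rescale {H : ℝ → ℝ} {p κ K σ : ℝ} (hσ : 0 < σ) (hp : 0 ≤ p)
    (hHm : Measurable H) (hH0 : ∀ r ≤ 0, H r = 0) (hHnn : ∀ r, 0 ≤ H r)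
    (hHK : ∀ r, 0 < r → H r ≤ K * r ^ p)
    (hH : Tendsto (fun r => H r / r ^ p) (nhdsWithin 0 (Set.Ioi 0)) (nhds κ)) :
    Tendsto (fun z : ℝ =>
      (∫ s, exp (-s) * exp (-s ^ 2 / (2 * z ^ 2)) * H (σ * (s / z))) / (σ / z) ^ p)
      atTop (nhds (κ * Gamma (p + 1))) := by
  have hΓ : ∫ s, (Set.Ioi (0 : ℝ)).indicator (fun s => κ * (exp (-s) * s ^ p)) s
      = κ * Gamma (p + 1) := by
    rw [integral_indicator measurableSet_Ioi, integral_const_mul,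
      Gamma_eq_integral (by linarith), add_sub_cancel_right]
  have hint : IntegrableOn (fun s => exp (-s) * s ^ p) (Set.Ioi 0) := by
    simpa using GammaIntegral_convergent (s := p + 1) (by linarith)
  simp_rw [← hΓ, ← integral_div]
  refine tendsto_integral_filter_of_dominated_convergence
    ((Set.Ioi (0 : ℝ)).indicator (fun s => K * (exp (-s) * s ^ p))) ?_ ?_
    ((integrable_indicator_iff measurableSet_Ioi).2 (hint.const_mul K)) ?_
  · exact Eventually.of_forall fun z => (by fun_prop : Measurable fun s : ℝ =>
      exp (-s) * exp (-s ^ 2 / (2 * z ^ 2)) * H (σ * (s / z)) / (σ / z) ^ p).aestronglyMeasurable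
  · filter_upwards [eventually_gt_atTop 0] with z hz
    refine Eventually.of_forall fun s => ?_
    have hσz : 0 < σ / z := div_pos hσ hz
    rcases le_or_gt s 0 with hs | hs
    · have : σ * (s / z) ≤ 0 := mul_nonpos_of_nonneg_of_nonpos hσ.le
        (div_nonpos_of_nonpos_of_nonneg hs hz.le)
      simp [hH0 _ this, hs]
    · have hr : 0 < σ * (s / z) := by positivity
      have h1 : exp (-s ^ 2 / (2 * z ^ 2)) ≤ 1 := by
        rw [exp_le_one_iff, neg_div]
        exact neg_nonpos.2 (by positivity)
      have h2 := hHK _ hr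
      have h3 : σ * (s / z) = σ / z * s := by ring
      have h4 := hHnn (σ * (s / z))
      have h5 : 0 < (σ / z) ^ p := rpow_pos_of_pos hσz p
      rw [Set.indicator_of_mem (Set.mem_Ioi.2 hs), norm_of_nonneg (by positivity),
        div_le_iff₀ h5]
      calc exp (-s) * exp (-s ^ 2 / (2 * z ^ 2)) * H (σ * (s / z))
          ≤ exp (-s) * 1 * (K * (σ * (s / z)) ^ p) := by gcongr
        _ = K * (exp (-s) * s ^ p) * (σ / z) ^ p := by
            rw [h3, mul_rpow hσz.le hs.le]
            ring
  · refine Eventually.of_forall fun s => ?_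
    rcases le_or_gt s 0 with hs | hs
    · rw [Set.indicator_of_notMem (by simpa using hs)]
      refine Tendsto.congr' ?_ tendsto_const_nhds
      filter_upwards [eventually_gt_atTop 0] with z hz
      have : σ * (s / z) ≤ 0 := mul_nonpos_of_nonneg_of_nonpos hσ.le
        (div_nonpos_of_nonpos_of_nonneg hs hz.le)
      simp [hH0 _ this]
    · rw [Set.indicator_of_mem (Set.mem_Ioi.2 hs)]
      have harg : Tendsto (fun z : ℝ => σ * (s / z)) atTop (nhdsWithin 0 (Set.Ioi 0)) := by
        refine tendsto_nhdsWithin_iff.2 ⟨?_, ?_⟩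
        · simpa using (tendsto_const_nhds.div_atTop tendsto_id : Tendsto (fun z : ℝ => s / z)
            atTop (nhds 0)).const_mul σ
        · filter_upwards [eventually_gt_atTop 0] with z hz
          exact mul_pos hσ (div_pos hs hz)
      have hexp : Tendsto (fun z : ℝ => exp (-s ^ 2 / (2 * z ^ 2))) atTop (nhds 1) := by
        have h2 : Tendsto (fun z : ℝ => 2 * z ^ 2) atTop atTop :=
          (tendsto_pow_atTop two_ne_zero).const_mul_atTop two_pos
        have h3 : Tendsto (fun z : ℝ => -s ^ 2 / (2 * z ^ 2)) atTop (nhds 0) :=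
          tendsto_const_nhds.div_atTop h2
        simpa [Function.comp_def] using (continuous_exp.tendsto 0).comp h3
      have h := ((hH.comp harg).mul hexp).mul_const (exp (-s) * s ^ p)
      rw [mul_one] at h
      refine h.congr' ?_
      filter_upwards [eventually_gt_atTop 0] with z hz
      have hσz : 0 < σ / z := div_pos hσ hz
      have h3 : σ * (s / z) = σ / z * s := by ring
      have h5 : 0 < (σ / z) ^ p := rpow_pos_of_pos hσz p
      have h6 : 0 < s ^ p := rpow_pos_of_pos hs p
      simp only [Function.comp_apply]
      rw [h3, mul_rpow hσz.le hs.le]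
      field_simp

/-- Replacing the argument `r` by the equivalent `1 - exp (-r)` preserves power asymptotics. -/
lemma tendsto_comp_one_sub_exp_div_rpow {G : ℝ → ℝ} {b κ : ℝ}
    (hG : Tendsto (fun r => G r / r ^ b) (nhdsWithin 0 (Set.Ioi 0)) (nhds κ)) :
    Tendsto (fun r => G (1 - exp (-r)) / r ^ b) (nhdsWithin 0 (Set.Ioi 0)) (nhds κ) := by
  have hpos : ∀ r : ℝ, 0 < r → 0 < 1 - exp (-r) := fun r hr => by
    have : exp (-r) < 1 := by simpa using hr
    linarith
  have hslope : Tendsto (fun r : ℝ => (1 - exp (-r)) / r) (nhdsWithin 0 (Set.Ioi 0))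
      (nhds 1) := by
    have hd : HasDerivAt (fun r : ℝ => 1 - exp (-r)) 1 0 := by
      simpa using ((hasDerivAt_neg (0 : ℝ)).exp).const_sub 1
    have := (hasDerivAt_iff_tendsto_slope_zero.1 hd).mono_left
      (nhdsWithin_mono 0 (s := Set.Ioi 0) fun r (hr : 0 < r) => hr.ne')
    simpa [div_eq_inv_mul] using this
  have harg : Tendsto (fun r : ℝ => 1 - exp (-r)) (nhdsWithin 0 (Set.Ioi 0))
      (nhdsWithin 0 (Set.Ioi 0)) := by
    refine tendsto_nhdsWithin_iff.2 ⟨?_, eventually_mem_nhdsWithin.mono hpos⟩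
    have : Tendsto (fun r : ℝ => 1 - exp (-r)) (nhds 0) (nhds (1 - exp (-0))) :=
      (by fun_prop : Continuous fun r : ℝ => 1 - exp (-r)).tendsto 0
    simpa using this.mono_left nhdsWithin_le_nhds
  have h := (hG.comp harg).mul (hslope.rpow_const (p := b) (Or.inl one_ne_zero))
  rw [one_rpow, mul_one] at h
  refine h.congr' ?_
  filter_upwards [self_mem_nhdsWithin] with r hr
  have hr : 0 < r := hr
  have h1 := hpos r hr
  have h2 := rpow_pos_of_pos hr b
  have h3 := rpow_pos_of_pos h1 b
  simp only [Function.comp_apply]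
  rw [div_rpow h1.le hr.le]
  field_simp

/-- The tail of the product of an independent pair `C`, `exp (σ * Z + μ)` at the level
`exp (σ * z + μ)`, as an integral over the law of `Z`. -/
lemma measureReal_mul_exp_gt {Ω : Type*} {m : MeasurableSpace Ω} {P : Measure Ω}
    [IsProbabilityMeasure P] {C Z : Ω → ℝ} (hC : Measurable C) (hZ : Measurable Z)
    (hind : IndepFun C Z P) (σ μ z : ℝ) :
    P.real {ω | C ω * exp (σ * Z ω + μ) > exp (σ * z + μ)}
      = ∫ x, (P.map C).real (Set.Ioi (1 - (1 - exp (-(σ * (x - z)))))) ∂(P.map Z) := by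
  have : IsProbabilityMeasure (P.map C) := Measure.isProbabilityMeasure_map hC.aemeasurable
  have : IsProbabilityMeasure (P.map Z) := Measure.isProbabilityMeasure_map hZ.aemeasurable
  have hprod := (indepFun_iff_map_prod_eq_prod_map_map hC.aemeasurable hZ.aemeasurable).1 hind
  set S : Set (ℝ × ℝ) := {q | exp (σ * z + μ) < q.1 * exp (σ * q.2 + μ)} with hS
  have hSm : MeasurableSet S := measurableSet_lt (by fun_prop) (by fun_prop)
  have hslice : ∀ x, (fun c => (c, x)) ⁻¹' S
      = Set.Ioi (1 - (1 - exp (-(σ * (x - z))))) := by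
    intro x
    ext c
    simp only [hS, Set.mem_preimage, Set.mem_ofPred_eq, Set.mem_Ioi, sub_sub_cancel]
    rw [← div_lt_iff₀ (exp_pos _), ← exp_sub]
    ring_nf
  have h1 : P {ω | C ω * exp (σ * Z ω + μ) > exp (σ * z + μ)}
      = ∫⁻ x, (P.map C) (Set.Ioi (1 - (1 - exp (-(σ * (x - z)))))) ∂(P.map Z) := by
    have : P {ω | C ω * exp (σ * Z ω + μ) > exp (σ * z + μ)}
        = (P.map fun ω => (C ω, Z ω)) S := by
      rw [Measure.map_apply (hC.prodMk hZ) hSm]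
      rfl
    rw [this, hprod, Measure.prod_apply_symm hSm]
    simp_rw [hslice]
  have hmeas : Measurable fun x => (P.map C) (Set.Ioi (1 - (1 - exp (-(σ * (x - z)))))) := by
    have := measurable_measure_prodMk_right (μ := P.map C) hSm
    simpa only [hslice] using this
  rw [measureReal_def, h1, ← integral_toReal hmeas.aemeasurable
    (Eventually.of_forall fun x => measure_lt_top _ _)]
  rfl

/-- Application: for a Log-Normal risk `X₁ = exp(σZ + μ)` and an independent
Beta(a,b)-distributed deflator `C₁`, with auxiliary function
`a(t) = σ²t/(log t − μ)` one has
`P(C₁X₁ > t) ~ Γ(b+1)·P(C₁ > 1 − a(t)/t)·P(X₁ > t)` as `t → ∞`. -/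
theorem lognormal_beta_product_tail
    {Ω : Type*} [MeasureSpace Ω] [IsProbabilityMeasure (ℙ : Measure Ω)]
    (σ μ : ℝ) (hσ : 0 < σ)
    (Z : Ω → ℝ) (hZmeas : Measurable Z)
    (hZ : Measure.map Z (ℙ : Measure Ω) = gaussianReal 0 1)
    (X₁ : Ω → ℝ) (hX₁ : ∀ ω, X₁ ω = Real.exp (σ * Z ω + μ))
    (b a : ℝ) (hb : 0 < b) (ha : 0 < a)
    (C₁ : Ω → ℝ) (hC₁meas : Measurable C₁)
    -- `C₁` is Beta(a, b) distributed on [0,1]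
    (hBeta : Measure.map C₁ (ℙ : Measure Ω) =
      (volume : Measure ℝ).withDensity (fun x =>
        ENNReal.ofReal (if x ∈ Set.Ioo (0 : ℝ) 1 then
          x ^ (a - 1) * (1 - x) ^ (b - 1) /
            (Real.Gamma a * Real.Gamma b / Real.Gamma (a + b)) else 0)))
    (hindep : IndepFun C₁ X₁ ℙ) :
    Tendsto (fun t : ℝ =>
        (ℙ {ω | C₁ ω * X₁ ω > t}).toReal /
          (Real.Gamma (b + 1) *
            (ℙ {ω | C₁ ω > 1 - (σ ^ 2 * t / (Real.log t - μ)) / t}).toReal *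
            (ℙ {ω | X₁ ω > t}).toReal)) atTop (nhds 1) := by
  have hB : 0 < Real.Gamma a * Real.Gamma b / Real.Gamma (a + b) :=
    div_pos (mul_pos (Gamma_pos_of_pos ha) (Gamma_pos_of_pos hb)) (Gamma_pos_of_pos (by linarith))
  set B := Real.Gamma a * Real.Gamma b / Real.Gamma (a + b) with hBdef
  set κ := 1 / (b * B) with hκdef
  have hκ : 0 < κ := by positivity
  obtain rfl : X₁ = fun ω => exp (σ * Z ω + μ) := funext hX₁
  have hindZ : IndepFun C₁ Z ℙ := by
    have h := hindep.comp (φ := id) (ψ := fun x : ℝ => (Real.log x - μ) / σ) measurable_id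
      (by fun_prop)
    have e : (fun x : ℝ => (Real.log x - μ) / σ) ∘ (fun ω => exp (σ * Z ω + μ)) = Z := by
      ext ω
      simp [hσ.ne']
    rwa [e, Function.id_comp] at h
  have hprobC : IsProbabilityMeasure (Measure.map C₁ (ℙ : Measure Ω)) :=
    Measure.isProbabilityMeasure_map hC₁meas.aemeasurable
  set G : ℝ → ℝ := fun r => (Measure.map C₁ (ℙ : Measure Ω)).real (Set.Ioi (1 - r)) with hGdef
  have hGmono : Monotone G := fun r s hrs =>
    measureReal_mono (Set.Ioi_subset_Ioi (by linarith))
  have hGlim : Tendsto (fun r => G r / r ^ b) (nhdsWithin 0 (Set.Ioi 0)) (nhds κ) := by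
    simp only [hGdef, hBeta]
    exact tendsto_beta_tail_div_rpow ha hb hB
  have hG0 : ∀ r ≤ 0, G r = 0 := by
    intro r hr
    simp only [hGdef, hBeta, measureReal_def]
    rw [withDensity_apply _ measurableSet_Ioi, setLIntegral_eq_zero measurableSet_Ioi]
    · simp
    · intro x (hx : 1 - r < x)
      have : ¬ x ∈ Set.Ioo (0 : ℝ) 1 := fun h => by linarith [h.2]
      simp [this]
  obtain ⟨K, hK⟩ := exists_le_mul_rpow_of_tendsto hb.le (fun r => measureReal_le_one) hGlim
  set H : ℝ → ℝ := fun r => G (1 - exp (-r)) with hHdef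
  have hnum := tendsto_integral_exp_rescale (H := H) (K := K) hσ hb.le
    (hGmono.measurable.comp (by fun_prop))
    (fun r hr => hG0 _ (by simpa using hr)) (fun r => measureReal_nonneg)
    (fun r hr => (hGmono (by linarith [add_one_le_exp (-r)])).trans (hK r hr))
    (tendsto_comp_one_sub_exp_div_rpow hGlim)
  set J : ℝ → ℝ := (Set.Ioi (0 : ℝ)).indicator 1 with hJdef
  have hden := tendsto_integral_exp_rescale (H := J) (p := 0) (κ := 1) (K := 1) hσ le_rfl
    (measurable_one.indicator measurableSet_Ioi)
    (fun r hr => Set.indicator_of_notMem (by simpa using hr) _)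
    (fun r => Set.indicator_nonneg (fun _ _ => zero_le_one) r)
    (fun r hr => by simp [hJdef, hr])
    (tendsto_const_nhds.congr' (by
      filter_upwards [self_mem_nhdsWithin] with r hr
      have hr : 0 < r := hr
      simp [hJdef, hr]))
  simp only [zero_add, Gamma_one, mul_one, rpow_zero, div_one] at hden
  have hh : Tendsto (fun z : ℝ => σ / z) atTop (nhdsWithin 0 (Set.Ioi 0)) :=
    tendsto_nhdsWithin_iff.2 ⟨tendsto_const_nhds.div_atTop tendsto_id, by
      filter_upwards [eventually_gt_atTop 0] with z hz using div_pos hσ hz⟩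
  have hΓ : 0 < Gamma (b + 1) := Gamma_pos_of_pos (by linarith)
  have hratio := hnum.div (((hGlim.comp hh).const_mul (Gamma (b + 1))).mul hden) (by positivity)
  have hone : κ * Gamma (b + 1) / (Gamma (b + 1) * κ * 1) = 1 := by field_simp
  rw [hone] at hratio
  have hz : Tendsto (fun t : ℝ => (Real.log t - μ) / σ) atTop atTop :=
    (tendsto_atTop_add_const_right _ (-μ) tendsto_log_atTop).atTop_div_const hσ
  refine (hratio.comp hz).congr' ?_
  filter_upwards [eventually_gt_atTop 0, hz.eventually_gt_atTop 0] with t ht hzt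
  simp only [Function.comp_apply, Pi.div_apply]
  set z := (Real.log t - μ) / σ with hzdef
  have hlog : Real.log t - μ = σ * z := by rw [hzdef]; field_simp
  have htz : t = exp (σ * z + μ) := by rw [← hlog, sub_add_cancel, exp_log ht]
  have hprod : (ℙ {ω | C₁ ω * exp (σ * Z ω + μ) > t}).toReal
      = gaussianPDFReal 0 1 z / z *
        ∫ s, exp (-s) * exp (-s ^ 2 / (2 * z ^ 2)) * H (σ * (s / z)) := by
    rw [← integral_gaussianReal_rescale (fun x => H (σ * x)) hzt, ← hZ, htz]
    exact measureReal_mul_exp_gt hC₁meas hZmeas hindZ σ μ z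
  have hX : (ℙ {ω | exp (σ * Z ω + μ) > t}).toReal
      = gaussianPDFReal 0 1 z / z *
        ∫ s, exp (-s) * exp (-s ^ 2 / (2 * z ^ 2)) * J (σ * (s / z)) := by
    rw [← integral_gaussianReal_rescale (fun x => J (σ * x)) hzt, ← hZ, htz]
    have e : ∀ x, J (σ * (x - z)) = (Set.Ioi z).indicator 1 x := fun x => by
      simp only [hJdef, Set.indicator, Set.mem_Ioi, mul_pos_iff_of_pos_left hσ, sub_pos]
      rfl
    simp_rw [e]
    rw [integral_indicator_one measurableSet_Ioi,
      map_measureReal_apply hZmeas measurableSet_Ioi, measureReal_def]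
    congr 2
    ext ω
    simp [hσ]
  have hC : (ℙ {ω | C₁ ω > 1 - (σ ^ 2 * t / (Real.log t - μ)) / t}).toReal = G (σ / z) := by
    have e : σ ^ 2 * t / (Real.log t - μ) / t = σ / z := by
      rw [hlog]
      field_simp
    rw [e, hGdef]
    simp only
    rw [map_measureReal_apply hC₁meas measurableSet_Ioi]
    rfl
  rw [hprod, hX, hC]
  have hφ := gaussianPDFReal_pos 0 1 z one_ne_zero
  have hhb : 0 < (σ / z) ^ b := rpow_pos_of_pos (div_pos hσ hzt) b
  set I₁ := ∫ s, exp (-s) * exp (-s ^ 2 / (2 * z ^ 2)) * H (σ * (s / z))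
  set I₀ := ∫ s, exp (-s) * exp (-s ^ 2 / (2 * z ^ 2)) * J (σ * (s / z))
  generalize (σ / z) ^ b = w at hhb ⊢
  generalize G (σ / z) = v
  have hc : gaussianPDFReal 0 1 z / z ≠ 0 := (div_pos hφ hzt).ne'
  rw [show Gamma (b + 1) * v * (gaussianPDFReal 0 1 z / z * I₀)
    = gaussianPDFReal 0 1 z / z * (Gamma (b + 1) * v * I₀) by ring, mul_div_mul_left _ _ hc,
    show Gamma (b + 1) * (v / w) * I₀ = Gamma (b + 1) * v * I₀ / w by ring,
    div_div_div_cancel_right₀ hhb.ne']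
end
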